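/- arXiv:1510.02331 — 2 statements merged into one kernel-verified Lean document; each statement's English description precedes it below -/
import Mathlib

section
/- Let B⁵₃ = {(x₁,x₂,x₃) ∈ ℝ³ : |x₁|⁵ + |x₂|⁵ + |x₃|⁵ ≤ 1} be the superball with parameter p = 5. Then every translative packing of B⁵₃ has upper density at most 0.9225. -/
open MeasureTheory Filter Metric

/-- A translative packing of `K`: a set of translation vectors such that the translates
of the interior of `K` are pairwise disjoint. -/
def IsTranslativePacking (K X : Set (EuclideanSpace ℝ (Fin 3))) : Prop :=
  ∀ x ∈ X, ∀ y ∈ X, x ≠ y →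
    Disjoint ((fun z => x + z) '' interior K) ((fun z => y + z) '' interior K)

/-- The upper density of a translative packing `X` of the body `K`. -/
noncomputable def packingUpperDensity (K X : Set (EuclideanSpace ℝ (Fin 3))) : ℝ :=
  Filter.limsup (fun r : ℝ => ⨆ c : EuclideanSpace ℝ (Fin 3),
    (volume (closedBall c r ∩ ⋃ x ∈ X, (fun z => x + z) '' K) /
      volume (closedBall c r)).toReal) Filter.atTop

namespace SB

/-- Horner evaluation of a list of coefficients. -/
def evL {α : Type} (val : α → ℝ) : List α → ℝ → ℝ
  | [], _ => 0
  | a :: as, x => val a + x * evL val as x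

/-- Binary form with coefficients `c_e x^e y^(m-e)`. -/
def evB : List Int → ℝ → ℝ → ℝ
  | [], _, _ => 0
  | c :: cs, x, y => c * y ^ cs.length + x * evB cs x y

def evT (T : List (List Int)) (x1 x2 x3 : ℝ) : ℝ := evL (fun r => evB r x2 x3) T x1

def evQ (G : List (List (List Int))) (x0 x1 x2 x3 : ℝ) : ℝ :=
  evL (fun T => evT T x1 x2 x3) G x0

def lin (a : Int) : Int → List Int → List Int
  | p, [] => [p]
  | p, l :: ls => (p + a * l) :: lin a l ls

def subB (a b : Int) : List Int → List Int
  | [] => []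
  | c :: cs => lin a (c * b ^ cs.length) (subB a b cs)

def zc {α : Type} (z : α) : List α → List (List α) → List (List α)
  | [], C => C.map (fun c => z :: c)
  | a :: as, [] => [a] :: zc z as []
  | a :: as, c :: cs => (a :: c) :: zc z as cs

def tr {α : Type} (z : α) : List (List α) → List (List α)
  | [] => []
  | r :: rs => zc z r (tr z rs)

def sw0 (G : List (List (List Int))) : List (List (List Int)) := tr [] G
def sw1 (G : List (List (List Int))) : List (List (List Int)) := G.map (tr 0)
def sw2 (G : List (List (List Int))) : List (List (List Int)) := G.map (List.map List.reverse)
def subA (a b : Int) (G : List (List (List Int))) : List (List (List Int)) :=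
  G.map (List.map (subB a b))

def tri : List (List Int) → Bool
  | [] => true
  | r :: rs => Nat.beq r.length (rs.length + 1) && tri rs

def shp : List (List (List Int)) → Bool
  | [] => true
  | T :: Ts => tri T && tri (tr 0 T) && Nat.beq (tr 0 T).length T.length && shp Ts

def nnI : Int → Bool
  | Int.ofNat _ => true
  | Int.negSucc _ => false

def nn1 : List Int → Bool
  | [] => true
  | c :: cs => nnI c && nn1 cs
def nn2 : List (List Int) → Bool
  | [] => true
  | c :: cs => nn1 c && nn2 cs
def nn3 : List (List (List Int)) → Bool
  | [] => true
  | c :: cs => nn2 c && nn3 cs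

structure Vx where
  t0 : Nat
  t1 : Nat
  t2 : Nat
  w : Nat

def Vx.comb (k l : Nat) (u v : Vx) : Vx :=
  ⟨k * u.t0 + l * v.t0, k * u.t1 + l * v.t1, k * u.t2 + l * v.t2, k * u.w + l * v.w⟩

def nw (n : Nat) : Nat → Nat → Nat
  | 0, u => u + 1
  | k + 1, u => nw n k ((u + n / u) / 2)

def rt (n : Nat) : Nat := nw n 9 (2 ^ (Nat.log2 n / 2 + 1))

def rtOK (n : Nat) : Bool := Nat.ble n (rt n * rt n)

def ins (ρ : Nat) (v : Vx) : Bool :=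
  rtOK (v.t0 * v.w * 2 ^ 40) && rtOK (v.t1 * v.w * 2 ^ 40) && rtOK (v.t2 * v.w * 2 ^ 40) &&
  Nat.blt 0 v.w &&
  Nat.blt (32 * (v.t0 ^ 2 * rt (v.t0 * v.w * 2 ^ 40) + v.t1 ^ 2 * rt (v.t1 * v.w * 2 ^ 40)
      + v.t2 ^ 2 * rt (v.t2 * v.w * 2 ^ 40))) (ρ * v.w ^ 3 * 2 ^ 20)

inductive Tr where
  | p : Tr
  | i : Tr
  | x : Tr → Tr
  | y : Tr → Tr
  | z : Tr → Tr
  | n : Nat → Nat → Tr → Tr → Tr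

def chk (ρ : Nat) : Tr → List (List (List Int)) → Vx → Vx → Vx → Vx → Bool
  | Tr.p, G, _, _, _, _ => nn3 G
  | Tr.i, _, a, b, c, d => ins ρ a && ins ρ b && ins ρ c && ins ρ d
  | Tr.x t, G, a, b, c, d => chk ρ t (sw0 G) b a c d
  | Tr.y t, G, a, b, c, d => shp G && chk ρ t (sw1 G) a c b d
  | Tr.z t, G, a, b, c, d => chk ρ t (sw2 G) a b d c
  | Tr.n k l t u, G, a, b, c, d => Nat.blt 0 k && Nat.blt 0 l &&
      chk ρ t (subA k l G) a b c (Vx.comb k l c d) &&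
      chk ρ u (subA l k (sw2 G)) a b d (Vx.comb k l c d)

def pA (G : List (List (List Int))) : List (List (List Int)) := sw1 (sw2 (sw0 (sw1 G)))
def okA (G : List (List (List Int))) : Bool := shp G && shp (sw2 (sw0 (sw1 G)))
def pB (G : List (List (List Int))) : List (List (List Int)) := sw2 (sw1 (sw0 G))
def okB (G : List (List (List Int))) : Bool := shp (sw0 G)

/-- substitution to the chamber `t0 ≥ t1 ≥ t2`. -/
def start (G : List (List (List Int))) : List (List (List Int)) :=
  pB (subA 1 1 (pB (subA 1 1 (pA G))))

def full (ρ : Nat) (T : Tr) (G : List (List (List Int))) : Bool :=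
  okA G && okB (subA 1 1 (pA G)) && okB (subA 1 1 (pB (subA 1 1 (pA G)))) &&
  chk ρ T (start G) ⟨1,0,0,0⟩ ⟨1,1,0,0⟩ ⟨1,1,1,0⟩ ⟨0,0,0,1⟩
end SB

namespace SB

theorem evL_map_cons {α : Type} (val : α → ℝ) (z : α) (hz : val z = 0) (x y : ℝ) (C : List (List α)) :
    evL (fun col => evL val col x) (C.map (fun c => z :: c)) y
      = x * evL (fun col => evL val col x) C y := by
  induction C with
  | nil => simp [evL]
  | cons c cs ih => simp only [List.map_cons, evL, ih, hz]; ring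

theorem evL_zc {α : Type} (val : α → ℝ) (z : α) (hz : val z = 0) (x y : ℝ) :
    ∀ (r : List α) (C : List (List α)),
    evL (fun col => evL val col x) (zc z r C) y
      = evL val r y + x * evL (fun col => evL val col x) C y
  | [], C => by simp only [zc, evL_map_cons val z hz, evL]; ring
  | a :: as, [] => by simp only [zc, evL, evL_zc val z hz x y as []]; ring
  | a :: as, c :: cs => by simp only [zc, evL, evL_zc val z hz x y as cs]; ring

theorem evL_tr {α : Type} (val : α → ℝ) (z : α) (hz : val z = 0) (x y : ℝ) (T : List (List α)) :
    evL (fun c => evL val c x) (tr z T) y = evL (fun r => evL val r y) T x := by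
  induction T with
  | nil => simp [evL, tr]
  | cons r rs ih => simp only [tr, evL_zc val z hz, ih, evL]

theorem evL_map {α β : Type} (val : β → ℝ) (f : α → β) (l : List α) (x : ℝ) :
    evL val (l.map f) x = evL (fun a => val (f a)) l x := by
  induction l with
  | nil => simp [evL]
  | cons c cs ih => simp only [List.map_cons, evL, ih]

theorem evQ_sw0 (G : List (List (List Int))) (a b c d : ℝ) : evQ (sw0 G) a b c d = evQ G b a c d := by
  unfold evQ evT sw0
  exact evL_tr (fun r => evB r c d) [] (by simp [evB]) b a G

theorem evB_scale (x y : ℝ) (hy : y ≠ 0) (l : List Int) :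
    y * evB l x y = y ^ l.length * evL (fun c : Int => (c : ℝ)) l (x / y) := by
  induction l with
  | nil => simp [evB, evL]
  | cons c cs ih =>
    have : y * evB (c :: cs) x y = c * y ^ (cs.length + 1) + x * (y * evB cs x y) := by
      simp only [evB]; ring
    rw [this, ih]
    simp only [evL, List.length_cons]
    field_simp
    ring

theorem evT_scale (x1 x2 y : ℝ) (hy : y ≠ 0) (T : List (List Int)) (hT : tri T = true) :
    y * evT T x1 x2 y = y ^ T.length *
      evL (fun r => evL (fun c : Int => (c : ℝ)) r (x2 / y)) T (x1 / y) := by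
  induction T with
  | nil => simp [evT, evL]
  | cons r rs ih =>
    simp only [tri, Bool.and_eq_true, Nat.beq_eq] at hT
    have h1 : y * evT (r :: rs) x1 x2 y = y * evB r x2 y + x1 * (y * evT rs x1 x2 y) := by
      simp only [evT, evL]; ring
    rw [h1, ih hT.2, evB_scale _ _ hy, hT.1]
    simp only [evL, List.length_cons]
    field_simp
    ring

theorem evB_cont (l : List Int) (x : ℝ) : Continuous (fun y => evB l x y) := by
  induction l with
  | nil => simp only [evB]; fun_prop
  | cons c cs ih => simp only [evB]; fun_prop

theorem evT_cont (T : List (List Int)) (x1 x2 : ℝ) : Continuous (fun y => evT T x1 x2 y) := by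
  unfold evT
  induction T with
  | nil => simp only [evL]; fun_prop
  | cons c cs ih => simp only [evL]; have := evB_cont c x2; fun_prop

theorem evT_tr (T : List (List Int)) (h1 : tri T = true) (h2 : tri (tr 0 T) = true)
    (h3 : (tr 0 T).length = T.length) (x1 x2 x3 : ℝ) :
    evT (tr 0 T) x1 x2 x3 = evT T x2 x1 x3 := by
  refine congrFun (Continuous.ext_on (dense_compl_singleton (0 : ℝ)) (evT_cont (tr 0 T) x1 x2)
    (evT_cont T x2 x1) ?_) x3
  intro y hy
  have hy : y ≠ 0 := hy
  refine mul_left_cancel₀ hy ?_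
  rw [evT_scale _ _ _ hy _ h1, evT_scale _ _ _ hy _ h2, h3]
  congr 1
  exact evL_tr (fun c : Int => (c : ℝ)) 0 (by simp) _ _ T

theorem evQ_sw1 (G : List (List (List Int))) (h : shp G = true) (a b c d : ℝ) :
    evQ (sw1 G) a b c d = evQ G a c b d := by
  unfold evQ sw1
  induction G with
  | nil => simp [evL]
  | cons T Ts ih =>
    simp only [shp, Bool.and_eq_true, Nat.beq_eq] at h
    obtain ⟨⟨⟨h1, h2⟩, h3⟩, h4⟩ := h
    simp only [List.map_cons, evL, ih h4, evT_tr T h1 h2 h3]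

theorem evB_append (l : List Int) (c : Int) (x y : ℝ) :
    evB (l ++ [c]) x y = y * evB l x y + c * x ^ l.length := by
  induction l with
  | nil => simp [evB]
  | cons a as ih =>
    simp only [List.cons_append, evB, ih, List.length_append, List.length_cons, List.length_nil]
    ring

theorem evB_reverse (l : List Int) (x y : ℝ) : evB l.reverse x y = evB l y x := by
  induction l with
  | nil => simp [evB]
  | cons a as ih =>
    simp only [List.reverse_cons, evB_append, evB, ih, List.length_reverse]; ring

theorem evQ_map (f : List Int → List Int) (G : List (List (List Int))) (a b c d c' d' : ℝ)
    (h : ∀ l, evB (f l) c d = evB l c' d') :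
    evQ (G.map (List.map f)) a b c d = evQ G a b c' d' := by
  unfold evQ evT
  simp only [evL_map, h]

theorem evQ_sw2 (G : List (List (List Int))) (a b c d : ℝ) : evQ (sw2 G) a b c d = evQ G a b d c :=
  evQ_map _ G a b c d d c (fun l => evB_reverse l c d)

theorem lin_length (a : Int) (p : Int) (l : List Int) : (lin a p l).length = l.length + 1 := by
  induction l generalizing p with
  | nil => simp [lin]
  | cons c cs ih => simp [lin, ih]

theorem subB_length (a b : Int) (l : List Int) : (subB a b l).length = l.length := by
  induction l with
  | nil => simp [subB]
  | cons c cs ih => simp [subB, lin_length, ih]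

theorem evB_lin (a p : Int) (l : List Int) (x y : ℝ) :
    evB (lin a p l) x y = p * y ^ l.length + (x + a * y) * evB l x y := by
  induction l generalizing p with
  | nil => simp [lin, evB]
  | cons c cs ih =>
    simp only [lin, evB, ih, lin_length, List.length_cons]; push_cast; ring

theorem evB_subB (a b : Int) (l : List Int) (x y : ℝ) :
    evB (subB a b l) x y = evB l (x + a * y) (b * y) := by
  induction l with
  | nil => simp [subB, evB]
  | cons c cs ih => simp only [subB, evB_lin, evB, ih, subB_length]; push_cast; ring

theorem evQ_subA (k l : Int) (G : List (List (List Int))) (a b c d : ℝ) :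
    evQ (subA k l G) a b c d = evQ G a b (c + k * d) (l * d) :=
  evQ_map _ G a b c d _ _ (fun r => evB_subB k l r c d)

theorem evL_nonneg {α : Type} (val : α → ℝ) (l : List α) (x : ℝ) (hx : 0 ≤ x)
    (h : ∀ a ∈ l, 0 ≤ val a) : 0 ≤ evL val l x := by
  induction l with
  | nil => simp [evL]
  | cons c cs ih =>
    simp only [evL]
    have h1 := h c (by simp)
    have h2 := ih (fun a ha => h a (by simp [ha]))
    positivity

theorem evB_nonneg (l : List Int) (hl : nn1 l = true) (x y : ℝ) (hx : 0 ≤ x) (hy : 0 ≤ y) :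
    0 ≤ evB l x y := by
  induction l with
  | nil => simp [evB]
  | cons c cs ih =>
    simp only [nn1, Bool.and_eq_true] at hl
    have h2 := ih hl.2
    have h1 : (0 : ℝ) ≤ c := by
      cases c with
      | ofNat n => simp
      | negSucc n => simp [nnI] at hl
    simp only [evB]
    positivity

theorem nn2_mem (T : List (List Int)) (h : nn2 T = true) : ∀ r ∈ T, nn1 r = true := by
  induction T with
  | nil => simp
  | cons c cs ih => simp only [nn2, Bool.and_eq_true] at h; simpa [h.1] using ih h.2

theorem nn3_mem (T : List (List (List Int))) (h : nn3 T = true) : ∀ r ∈ T, nn2 r = true := by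
  induction T with
  | nil => simp
  | cons c cs ih => simp only [nn3, Bool.and_eq_true] at h; simpa [h.1] using ih h.2

theorem evQ_nonneg (G : List (List (List Int))) (hG : nn3 G = true) (a b c d : ℝ)
    (ha : 0 ≤ a) (hb : 0 ≤ b) (hc : 0 ≤ c) (hd : 0 ≤ d) : 0 ≤ evQ G a b c d :=
  evL_nonneg _ _ _ ha (fun T hT => evL_nonneg _ _ _ hb
    (fun r hr => evB_nonneg r (nn2_mem T (nn3_mem G hG T hT) r hr) _ _ hc hd))

/-- the function `u ^ (5/2)` -/
noncomputable def hf (u : ℝ) : ℝ := u ^ 2 * √u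

theorem hf_eq (u : ℝ) (hu : 0 ≤ u) : hf u = u ^ (5 / 2 : ℝ) := by
  unfold hf
  rw [Real.sqrt_eq_rpow, ← Real.rpow_natCast, ← Real.rpow_add_of_nonneg hu (by norm_num) (by norm_num)]
  norm_num

theorem hf_conv (u v l m : ℝ) (hu : 0 ≤ u) (hv : 0 ≤ v) (hl : 0 ≤ l) (hm : 0 ≤ m) (h : l + m = 1) :
    hf (l * u + m * v) ≤ l * hf u + m * hf v := by
  rw [hf_eq u hu, hf_eq v hv, hf_eq _ (by positivity)]
  have := (convexOn_rpow (p := 5 / 2) (by norm_num)).2 (x := u) (y := v) (by simpa using hu)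
    (by simpa using hv) hl hm h
  simpa using this

abbrev P4 := ℝ × ℝ × ℝ × ℝ

def In (ρ : ℕ) (p : P4) : Prop :=
  0 ≤ p.1 ∧ 0 ≤ p.2.1 ∧ 0 ≤ p.2.2.1 ∧ 0 < p.2.2.2 ∧
    32 * (hf (p.1 / p.2.2.2) + hf (p.2.1 / p.2.2.2) + hf (p.2.2.1 / p.2.2.2)) < ρ

theorem hf_persp (t t' w w' : ℝ) (ht : 0 ≤ t) (ht' : 0 ≤ t') (hw : 0 < w) (hw' : 0 < w') :
    hf ((t + t') / (w + w')) ≤ w / (w + w') * hf (t / w) + w' / (w + w') * hf (t' / w') := by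
  have := hf_conv (t / w) (t' / w') (w / (w + w')) (w' / (w + w')) (by positivity) (by positivity)
    (by positivity) (by positivity) (by field_simp)
  convert this using 2
  field_simp

theorem In.add {ρ : ℕ} {p q : P4} (hp : In ρ p) (hq : In ρ q) : In ρ (p + q) := by
  obtain ⟨t0, t1, t2, w⟩ := p
  obtain ⟨s0, s1, s2, v⟩ := q
  obtain ⟨a0, a1, a2, a3, a4⟩ := hp
  obtain ⟨b0, b1, b2, b3, b4⟩ := hq
  simp only at a0 a1 a2 a3 a4 b0 b1 b2 b3 b4
  refine ⟨?_, ?_, ?_, ?_, ?_⟩ <;> simp only [Prod.mk_add_mk]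
  · positivity
  · positivity
  · positivity
  · positivity
  have h0 := hf_persp t0 s0 w v a0 b0 a3 b3
  have h1 := hf_persp t1 s1 w v a1 b1 a3 b3
  have h2 := hf_persp t2 s2 w v a2 b2 a3 b3
  have hl : 0 < w / (w + v) := by positivity
  have hm : 0 < v / (w + v) := by positivity
  have hlm : w / (w + v) + v / (w + v) = 1 := by field_simp
  set l := w / (w + v)
  set m := v / (w + v)
  have e1 := mul_lt_mul_of_pos_left a4 hl
  have e2 := mul_lt_mul_of_pos_left b4 hm
  have : (ρ : ℝ) = l * ρ + m * ρ := by rw [← add_mul, hlm, one_mul]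
  rw [this]
  nlinarith

theorem In.smul {ρ : ℕ} {p : P4} (hp : In ρ p) {x : ℝ} (hx : 0 < x) : In ρ (x • p) := by
  obtain ⟨t0, t1, t2, w⟩ := p
  obtain ⟨a0, a1, a2, a3, a4⟩ := hp
  simp only at a0 a1 a2 a3 a4
  refine ⟨?_, ?_, ?_, ?_, ?_⟩ <;> simp only [Prod.smul_mk, smul_eq_mul]
  · positivity
  · positivity
  · positivity
  · positivity
  rw [mul_div_mul_left _ _ hx.ne', mul_div_mul_left _ _ hx.ne', mul_div_mul_left _ _ hx.ne']
  exact a4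

def In' (ρ : ℕ) (p : P4) : Prop := p = 0 ∨ In ρ p

theorem In'.add {ρ : ℕ} {p q : P4} (hp : In' ρ p) (hq : In' ρ q) : In' ρ (p + q) := by
  rcases hp with rfl | hp
  · simpa using hq
  rcases hq with rfl | hq
  · rw [add_zero]; exact Or.inr hp
  · exact Or.inr (hp.add hq)

theorem In.smul' {ρ : ℕ} {p : P4} (hp : In ρ p) {x : ℝ} (hx : 0 ≤ x) : In' ρ (x • p) := by
  rcases hx.eq_or_lt with rfl | hx
  · left; simp
  · exact Or.inr (hp.smul hx)

def Vx.pt (v : Vx) : P4 := (v.t0, v.t1, v.t2, v.w)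

theorem comb_pt (k l : ℕ) (u v : Vx) : (Vx.comb k l u v).pt = (k : ℝ) • u.pt + (l : ℝ) • v.pt := by
  simp [Vx.comb, Vx.pt]

theorem hf_rt (t w : ℕ) (hw : 0 < w) (h : rtOK (t * w * 2 ^ 40) = true) :
    hf ((t : ℝ) / w) * (w ^ 3 * 2 ^ 20) ≤ t ^ 2 * rt (t * w * 2 ^ 40) := by
  have h1 : t * w * 2 ^ 40 ≤ rt (t * w * 2 ^ 40) * rt (t * w * 2 ^ 40) := by
    simpa [rtOK, Nat.ble_eq] using h
  set R := rt (t * w * 2 ^ 40)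
  have h2 : (t : ℝ) * w * 2 ^ 40 ≤ (R : ℝ) ^ 2 := by
    rw [sq]; exact_mod_cast h1
  have hw' : (0 : ℝ) < w := by exact_mod_cast hw
  have h3 : √((t : ℝ) / w) * (w * 2 ^ 20) ≤ R := by
    have : √((t : ℝ) / w) ≤ R / (w * 2 ^ 20) := by
      apply Real.sqrt_le_iff.mpr
      refine ⟨by positivity, ?_⟩
      rw [div_pow, div_le_div_iff₀ hw' (by positivity)]
      nlinarith
    rwa [le_div_iff₀ (by positivity)] at this
  have : hf ((t : ℝ) / w) * (w ^ 3 * 2 ^ 20) = t ^ 2 * (√((t : ℝ) / w) * (w * 2 ^ 20)) := by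
    unfold hf; field_simp
  rw [this]
  gcongr

theorem ins_sound (ρ : ℕ) (v : Vx) (h : ins ρ v = true) : In ρ v.pt := by
  simp only [ins, Bool.and_eq_true, Nat.blt_eq] at h
  obtain ⟨⟨⟨⟨h0, h1⟩, h2⟩, hw⟩, h3⟩ := h
  have e0 := hf_rt _ _ hw h0
  have e1 := hf_rt _ _ hw h1
  have e2 := hf_rt _ _ hw h2
  have e3 : (32 : ℝ) * ((v.t0 : ℝ) ^ 2 * rt (v.t0 * v.w * 2 ^ 40) + (v.t1 : ℝ) ^ 2 * rt (v.t1 * v.w * 2 ^ 40)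
      + (v.t2 : ℝ) ^ 2 * rt (v.t2 * v.w * 2 ^ 40)) < (ρ : ℝ) * (v.w : ℝ) ^ 3 * 2 ^ 20 := by
    exact_mod_cast h3
  have hw' : (0 : ℝ) < v.w := by exact_mod_cast hw
  refine ⟨by simp [Vx.pt], by simp [Vx.pt], by simp [Vx.pt], by simpa [Vx.pt] using hw, ?_⟩
  simp only [Vx.pt]
  have hp : (0 : ℝ) < (v.w : ℝ) ^ 3 * 2 ^ 20 := by positivity
  refine lt_of_mul_lt_mul_right ?_ hp.le
  clear h0 h1 h2 h3
  generalize hf ((v.t0 : ℝ) / v.w) = z0 at *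
  generalize hf ((v.t1 : ℝ) / v.w) = z1 at *
  generalize hf ((v.t2 : ℝ) / v.w) = z2 at *
  rw [mul_assoc (ρ : ℝ)] at e3
  generalize (v.w : ℝ) ^ 3 * 2 ^ 20 = W at *
  nlinarith [e0, e1, e2, e3]

theorem chk_sound (ρ : ℕ) (T : Tr) : ∀ (G : List (List (List Int))) (a b c d : Vx),
    chk ρ T G a b c d = true → ∀ x0 x1 x2 x3 : ℝ, 0 ≤ x0 → 0 ≤ x1 → 0 ≤ x2 → 0 ≤ x3 →
    ∀ p : P4, p = x0 • a.pt + x1 • b.pt + x2 • c.pt + x3 • d.pt → p ≠ 0 → ¬ In ρ p →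
    0 ≤ evQ G x0 x1 x2 x3 := by
  induction T with
  | p =>
    intro G a b c d h x0 x1 x2 x3 h0 h1 h2 h3 p hp hn hI
    exact evQ_nonneg G h _ _ _ _ h0 h1 h2 h3
  | i =>
    intro G a b c d h x0 x1 x2 x3 h0 h1 h2 h3 p hp hn hI
    simp only [chk, Bool.and_eq_true] at h
    obtain ⟨⟨⟨ha, hb⟩, hc⟩, hd⟩ := h
    have := ((((ins_sound _ _ ha).smul' h0).add ((ins_sound _ _ hb).smul' h1)).add
      ((ins_sound _ _ hc).smul' h2)).add ((ins_sound _ _ hd).smul' h3)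
    rw [← hp] at this
    rcases this with h | h
    · exact absurd h hn
    · exact absurd h hI
  | x t ih =>
    intro G a b c d h x0 x1 x2 x3 h0 h1 h2 h3 p hp hn hI
    rw [← evQ_sw0]
    exact ih _ _ _ _ _ h _ _ _ _ h1 h0 h2 h3 p (by rw [hp]; abel) hn hI
  | y t ih =>
    intro G a b c d h x0 x1 x2 x3 h0 h1 h2 h3 p hp hn hI
    simp only [chk, Bool.and_eq_true] at h
    rw [← evQ_sw1 _ h.1]
    exact ih _ _ _ _ _ h.2 _ _ _ _ h0 h2 h1 h3 p (by rw [hp]; abel) hn hI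
  | z t ih =>
    intro G a b c d h x0 x1 x2 x3 h0 h1 h2 h3 p hp hn hI
    rw [← evQ_sw2]
    exact ih _ _ _ _ _ h _ _ _ _ h0 h1 h3 h2 p (by rw [hp]; abel) hn hI
  | n k l t u iht ihu =>
    intro G a b c d h x0 x1 x2 x3 h0 h1 h2 h3 p hp hn hI
    simp only [chk, Bool.and_eq_true, Nat.blt_eq] at h
    obtain ⟨⟨⟨hk, hl⟩, ht⟩, hu⟩ := h
    have hk' : (0 : ℝ) < k := by exact_mod_cast hk
    have hl' : (0 : ℝ) < l := by exact_mod_cast hl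
    rcases le_total (k * x3) (l * x2) with hc | hc
    · have := iht _ _ _ _ _ ht x0 x1 (x2 - k * x3 / l) (x3 / l) h0 h1
        (by rw [sub_nonneg, div_le_iff₀ hl']; linarith) (by positivity) p ?_ hn hI
      · rw [evQ_subA] at this
        convert this using 1
        push_cast
        congr 1 <;> field_simp
        ring
      · rw [hp, comb_pt]
        ext <;> simp <;> field_simp <;> ring
    · have := ihu _ _ _ _ _ hu x0 x1 (x3 - l * x2 / k) (x2 / k) h0 h1
        (by rw [sub_nonneg, div_le_iff₀ hk']; linarith) (by positivity) p ?_ hn hI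
      · rw [evQ_subA, evQ_sw2] at this
        convert this using 1
        push_cast
        congr 1 <;> field_simp
        ring
      · rw [hp, comb_pt]
        ext <;> simp <;> field_simp <;> ring

theorem evQ_pA (G : List (List (List Int))) (h : okA G = true) (a b c d : ℝ) :
    evQ (pA G) a b c d = evQ G c d a b := by
  simp only [okA, Bool.and_eq_true] at h
  rw [pA, evQ_sw1 _ h.2, evQ_sw2, evQ_sw0, evQ_sw1 _ h.1]

theorem evQ_pB (G : List (List (List Int))) (h : okB G = true) (a b c d : ℝ) :
    evQ (pB G) a b c d = evQ G d a b c := by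
  rw [pB, evQ_sw2, evQ_sw1 _ h, evQ_sw0]

theorem full_sound (ρ : ℕ) (T : Tr) (G : List (List (List Int))) (h : full ρ T G = true)
    (t0 t1 t2 : ℝ) (h0 : t1 ≤ t0) (h1 : t2 ≤ t1) (h2 : 0 ≤ t2) (hI : ¬ In ρ (t0, t1, t2, 1)) :
    0 ≤ evQ G t0 t1 t2 1 := by
  simp only [full, Bool.and_eq_true] at h
  obtain ⟨⟨⟨ha, hb⟩, hc⟩, hd⟩ := h
  have := chk_sound ρ T _ _ _ _ _ hd (t0 - t1) (t1 - t2) t2 1 (by linarith) (by linarith) h2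
    zero_le_one (t0, t1, t2, 1) (by ext <;> simp [Vx.pt]) (by simp [Prod.ext_iff]) hI
  rw [start, evQ_pB _ hc, evQ_subA, evQ_pB _ hb, evQ_subA, evQ_pA _ ha] at this
  convert this using 1
  congr 1 <;> push_cast <;> ring
end SB

namespace SB

noncomputable def hx (n : ℕ) (x : ℝ) : ℝ := x ^ n * Real.exp (-x ^ 2 / 2)

theorem hx_cont (n : ℕ) : Continuous (hx n) := by unfold hx; fun_prop

theorem hx_int (n : ℕ) : Integrable (hx n) := by
  have := integrable_rpow_mul_exp_neg_mul_sq (b := 1 / 2) (by norm_num) (s := n)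
    (by have : (0 : ℝ) ≤ n := by positivity
        linarith)
  refine this.congr (Filter.Eventually.of_forall fun x => ?_)
  simp only [hx, Real.rpow_natCast]
  congr 2; ring

theorem hx_deriv (n : ℕ) (x : ℝ) :
    HasDerivAt (hx n) (n * hx (n - 1) x - hx (n + 1) x) x := by
  have h1 := hasDerivAt_pow n x
  have h2 : HasDerivAt (fun x : ℝ => -x ^ 2 / 2) (-x) x := by
    have := ((hasDerivAt_pow 2 x).neg).div_const 2
    refine HasDerivAt.congr_deriv this ?_
    norm_num; ring
  have := h1.mul h2.exp
  refine this.congr_deriv ?_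
  simp only [hx, pow_succ]
  ring

theorem fi_int (n : ℕ) (x : ℝ) :
    Integrable (fun ξ : ℝ => ((hx n ξ : ℝ) : ℂ) * Complex.exp (Complex.I * x * ξ)) := by
  refine ((hx_int n).norm).mono' ?_ ?_
  · have := hx_cont n
    exact Continuous.aestronglyMeasurable (by fun_prop)
  · refine Filter.Eventually.of_forall fun ξ => ?_
    rw [norm_mul, Complex.norm_real]
    have : Complex.I * x * ξ = ((x * ξ : ℝ) : ℂ) * Complex.I := by push_cast; ring
    rw [this, Complex.norm_exp_ofReal_mul_I, mul_one]

noncomputable def fi (n : ℕ) (x : ℝ) : ℂ :=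
  ∫ ξ : ℝ, ((hx n ξ : ℝ) : ℂ) * Complex.exp (Complex.I * x * ξ)

theorem fi_rec (n : ℕ) (x : ℝ) :
    fi (n + 1) x = Complex.I * x * fi n x + n * fi (n - 1) x := by
  have key := integral_eq_zero_of_hasDerivAt_of_integrable
    (f := fun ξ : ℝ => ((hx n ξ : ℝ) : ℂ) * Complex.exp (Complex.I * x * ξ))
    (f' := fun ξ : ℝ => n * (((hx (n - 1) ξ : ℝ) : ℂ) * Complex.exp (Complex.I * x * ξ))
      - ((hx (n + 1) ξ : ℝ) : ℂ) * Complex.exp (Complex.I * x * ξ)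
      + Complex.I * x * (((hx n ξ : ℝ) : ℂ) * Complex.exp (Complex.I * x * ξ)))
    (fun ξ => by
      have h1 := (hx_deriv n ξ).ofReal_comp
      have h2 : HasDerivAt (fun ξ : ℝ => Complex.I * x * (ξ : ℂ)) (Complex.I * x) ξ := by
        simpa using (Complex.ofRealCLM.hasDerivAt (x := ξ)).const_mul (Complex.I * x)
      have := h1.mul h2.cexp
      refine this.congr_deriv ?_
      push_cast
      ring)
    ((((fi_int (n - 1) x).const_mul _).sub (fi_int (n + 1) x)).add ((fi_int n x).const_mul _))
    (fi_int n x)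
  rw [integral_add (f := fun ξ : ℝ => n * (((hx (n - 1) ξ : ℝ) : ℂ) * Complex.exp (Complex.I * x * ξ))
      - ((hx (n + 1) ξ : ℝ) : ℂ) * Complex.exp (Complex.I * x * ξ))
    (((fi_int (n - 1) x).const_mul _).sub (fi_int (n + 1) x))
    ((fi_int n x).const_mul _), integral_sub ((fi_int (n - 1) x).const_mul _) (fi_int (n + 1) x),
    integral_const_mul, integral_const_mul] at key
  change n * fi (n - 1) x - fi (n + 1) x + Complex.I * x * fi n x = 0 at key
  linear_combination -key

theorem fi_zero (x : ℝ) : fi 0 x = ((√(2 * Real.pi) * Real.exp (-x ^ 2 / 2) : ℝ) : ℂ) := by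
  have := fourierIntegral_gaussian (b := 1 / 2) (by norm_num) (x : ℂ)
  unfold fi hx
  have e : ∀ ξ : ℝ, ((ξ ^ 0 * Real.exp (-ξ ^ 2 / 2) : ℝ) : ℂ) * Complex.exp (Complex.I * x * ξ)
      = Complex.exp (Complex.I * x * ξ) * Complex.exp (-(1 / 2) * (ξ : ℂ) ^ 2) := by
    intro ξ
    push_cast
    rw [mul_comm]
    congr 1
    rw [pow_zero, one_mul]; congr 1; ring
  simp_rw [e]
  rw [this]
  push_cast
  congr 1
  · rw [Real.sqrt_eq_rpow, Complex.ofReal_cpow (by positivity)]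
    push_cast
    congr 1
    ring
  · congr 1; ring

/-- Hermite polynomials. -/
noncomputable def He : ℕ → ℝ → ℝ
  | 0, _ => 1
  | 1, x => x
  | n + 2, x => x * He (n + 1) x - (n + 1) * He n x

theorem fi_eq (n : ℕ) (x : ℝ) :
    fi n x = Complex.I ^ n * ((√(2 * Real.pi) * (He n x * Real.exp (-x ^ 2 / 2)) : ℝ) : ℂ) := by
  induction n using Nat.twoStepInduction with
  | zero => rw [fi_zero]; simp [He]
  | one => rw [fi_rec, fi_zero]; simp [He]; ring
  | more n h1 h2 =>
    rw [fi_rec, h2, Nat.add_sub_cancel, h1]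
    simp only [He]
    push_cast
    linear_combination (Complex.I ^ n * (n + 1) * He n x *
      (√(2 * Real.pi) : ℝ) * Complex.exp (-x ^ 2 / 2)) * Complex.I_sq

theorem He_deriv (n : ℕ) (x : ℝ) : HasDerivAt (He n) (n * He (n - 1) x) x := by
  induction n using Nat.twoStepInduction with
  | zero => simpa [He] using hasDerivAt_const x (1 : ℝ)
  | one => simpa [He] using hasDerivAt_id' x
  | more n h1 h2 =>
    have := ((hasDerivAt_id' x).mul h2).sub (h1.const_mul ((n : ℝ) + 1))
    have e : He (n + 2) = fun y => y * He (n + 1) y - (n + 1) * He n y := by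
      funext y; rfl
    rw [e]
    refine this.congr_deriv ?_
    rcases n with _ | n
    · simp [He]; ring
    · simp [He]; ring

theorem He_int (n : ℕ) : Integrable (fun x => He n x * Real.exp (-x ^ 2 / 2)) ∧
    ∀ k : ℕ, Integrable (fun x => x ^ k * He n x * Real.exp (-x ^ 2 / 2)) := by
  suffices h : ∀ k : ℕ, Integrable (fun x => x ^ k * He n x * Real.exp (-x ^ 2 / 2)) from
    ⟨by simpa using h 0, h⟩
  induction n using Nat.twoStepInduction with
  | zero => intro k; simpa [He, hx] using (show Integrable (fun x => hx k x) from hx_int k)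
  | one => intro k; simpa only [He, hx, pow_succ] using (show Integrable (fun x => hx (k + 1) x) from hx_int (k + 1))
  | more n h1 h2 =>
    intro k
    have := (h2 (k + 1)).sub ((h1 k).const_mul ((n : ℝ) + 1))
    refine this.congr (Filter.Eventually.of_forall fun x => ?_)
    simp only [He, Pi.sub_apply]; ring

theorem He_integral (n : ℕ) : ∫ x, He (n + 1) x * Real.exp (-x ^ 2 / 2) = 0 := by
  have h2 : ∀ x : ℝ, HasDerivAt (fun x : ℝ => -x ^ 2 / 2) (-x) x := by
    intro x
    have := ((hasDerivAt_pow 2 x).neg).div_const 2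
    refine HasDerivAt.congr_deriv this ?_
    norm_num; ring
  refine integral_eq_zero_of_hasDerivAt_of_integrable
    (f := fun x => -(He n x * Real.exp (-x ^ 2 / 2))) (fun x => ?_) (He_int _).1 (He_int n).1.neg
  have := ((He_deriv n x).mul (h2 x).exp).neg
  refine this.congr_deriv ?_
  rcases n with _ | n
  · simp [He, mul_comm]
  · simp [He]; ring

theorem He_integral_zero : ∫ x, He 0 x * Real.exp (-x ^ 2 / 2) = √(2 * Real.pi) := by
  have := integral_gaussian (1 / 2)
  simp only [He, one_mul]
  rw [show 2 * Real.pi = Real.pi / (1 / 2) by ring, ← this]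
  congr 1; funext x; congr 1; ring

theorem He_cont (n : ℕ) : Continuous (He n) :=
  continuous_iff_continuousAt.2 fun x => (He_deriv n x).continuousAt
end SB

namespace SB

open Tr in
def treeQ : Tr :=
  (x (y (n 6 1 (z (y (n 1 1 (y (z (x (y (n 6 1 p (z (x (y (n 6 1 (z (y (n 1 6 (z (x (y (n 6 1 p
  p)))) p))) (z (x (y (n 6 1 (z (x (y (n 1 6 p p)))) (n 1 1 (z (y (n 1 1 p (z (x (y (n 1 1 p (z (x
  (y (n 1 2 p (z (x (y (n 1 2 p (z (x (y (n 1 2 p (z (x (y (n 1 4 p (z (x (y (n 1 4 p (z (x (y (n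
  1 4 p (z (x (y (n 1 8 p p))))))))))))))))))))))))))))))))))) p)))))))))))))) (z (y (n 1 6 (z (x
  (y (n 6 1 (z (y (n 1 6 (z (x (y (n 6 1 p (z (x (y (n 1 1 (z (y (n 1 1 (z (y (n 1 2 p p))) p)))
  (z (y (n 1 1 (z (y (n 1 2 p p))) p))))))))))) p))) (z (x (y (n 6 1 (z (x (y (n 1 6 (z (y (n 1 1
  p (z (x (y (n 1 1 (z (x (y (n 1 1 (z (y (n 1 2 p p))) p)))) (z (x (y (n 1 1 (z (y (n 1 2 p p)))
  p))))))))))) p)))) (n 1 1 (z (y (n 1 1 p (z (x (y (n 1 1 p (z (x (y (n 1 2 p (z (x (y (n 1 2 p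
  (z (y (n 1 4 p (z (x (y (n 1 2 p (z (x (y (n 1 4 p (z (x (y (n 1 8 p (z (x (y (n 1 4 p
  p)))))))))))))))))))))))))))))))))) (z (x (y (n 1 1 p p))))))))))))) (z (x (y (n 1 1 (z (y (n 1
  6 (z (y (n 6 1 p (z (x (y (n 6 1 p (n 1 1 (z (y (n 1 1 p p))) p)))))))) p))) (z (y (n 1 6 (z (y
  (n 6 1 (z (y (n 1 6 (z (x (y (n 6 1 p (n 1 1 (z (y (n 1 1 p p))) p))))) p))) (z (x (y (n 6 1 (z
  (x (y (n 1 6 (z (y (n 1 1 p (z (y (n 1 1 p p)))))) p)))) (n 1 1 (z (y (n 1 1 p p))) (z (x (y (n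
  1 1 p p)))))))))))) (z (x (y (n 1 1 (y (z (x (y (n 6 1 p (z (x (y (n 6 1 p (z (x (y (n 6 1 p (z
  (y (n 1 1 p (z (y (n 1 1 p (z (x (y (n 1 1 p p))))))))))))))))))))))) (z (y (n 1 6 (z (x (y (n 6
  1 (z (y (n 1 6 (z (x (y (n 6 1 p (n 1 1 (z (x (y (n 1 1 p p)))) p))))) p))) (z (x (y (n 6 1 (z
  (x (y (n 1 6 (z (y (n 1 1 p (z (y (n 1 1 p (z (x (y (n 1 1 p p)))))))))) p)))) (n 1 1 (z (y (n 1
  1 (z (x (y (n 1 1 p p)))) p))) (z (x (y (n 1 1 (z (x (y (n 1 1 p p)))) p))))))))))))) (z (y (n 1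
  1 (y (z (x (y (n 6 1 p (z (x (y (n 6 1 p p))))))))) (z (x (y (n 1 1 (z (x (y (n 1 6 p p)))) (z
  (x (y (n 1 6 p p))))))))))))))))))))))))))))))) (z (x (y (n 6 1 (z (y (n 1 6 (z (x (y (n 6 1 (z
  (x (y (n 1 6 (z (y (n 1 1 p (y (z (x (y (n 1 1 p (z (x (y (n 1 1 (z (y (n 1 2 p p)))
  p)))))))))))) (z (x (y (n 1 6 p p)))))))) (n 1 1 (z (x (y (n 1 1 p (z (x (y (n 1 1 p (z (x (y (n
  1 2 p (z (y (n 1 2 p (z (x (y (n 1 2 p (z (x (y (n 1 4 p (z (x (y (n 1 4 p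
  p))))))))))))))))))))))))))) p))))) (z (y (n 1 6 (z (x (y (n 6 1 p (x (y (n 1 1 (z (y (n 1 1 (z
  (x (y (n 1 1 p p)))) p))) (z (y (n 1 1 (z (x (y (n 1 1 p (z (x (y (n 1 2 p p)))))))) p))))))))))
  p)))))) (z (x (y (n 6 1 (z (x (y (n 1 6 (z (y (n 1 1 p (z (y (n 1 1 p (z (x (y (n 1 1 p (z (x (y
  (n 1 2 p (z (x (y (n 1 2 p (z (x (y (n 1 2 p (z (x (y (n 1 4 p (z (x (y (n 1 4 p
  p)))))))))))))))))))))))))))))) (z (x (y (n 1 6 (z (y (n 1 1 p (z (x (y (n 1 1 (z (x (y (n 1 1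
  (z (y (n 1 2 p p))) p)))) (z (x (y (n 1 1 (z (y (n 1 2 p p))) p))))))))))) (z (x (y (n 1 6 p
  p)))))))))))) (n 1 1 (z (y (n 1 1 (z (x (y (n 1 1 p (z (x (y (n 1 2 p (z (x (y (n 1 2 p (y (z (x
  (y (n 2 1 (z (x (y (n 2 1 (z (y (n 1 8 p (z (x (y (n 1 4 p p))))))) p)))) (z (x (y (n 4 1 (z (y
  (n 1 8 p (z (x (y (n 1 4 p p))))))) p))))))))))))))))))))) p))) (z (x (y (n 1 1 (z (x (y (n 1 1
  (z (x (y (n 1 2 p p)))) p)))) (z (x (y (n 1 1 (z (x (y (n 1 2 (z (y (n 1 1 p p))) p)))) (x (y (n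
  1 1 (y (z (x (y (n 1 2 (z (x (y (n 1 1 (z (y (n 1 2 p p))) p)))) (z (x (y (n 1 2 (z (y (n 1 2 p
  (z (y (n 1 2 p p)))))) p))))))))) p)))))))))))))))))))))))

open Tr in
def treeP : Tr :=
  (x (y (n 6 1 (z (y (n 1 1 (y (z (x (y (n 6 1 (z (x (y (n 1 1 (z (y (n 1 6 (z (y (n 6 1 p p)))
  p))) (z (y (n 1 6 (z (y (n 6 1 p p))) p))))))) (z (x (y (n 6 1 (z (y (n 1 6 p p))) (z (x (y (n 6
  1 p (n 1 1 (z (y (n 1 1 p (z (x (y (n 1 1 p (z (x (y (n 1 2 p (z (x (y (n 1 2 p (z (x (y (n 1 2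
  p (z (x (y (n 1 4 p (z (x (y (n 1 4 p (z (x (y (n 1 4 p (z (x (y (n 1 8 p (n 688 21 (z (y (n 21
  344 p (z (x (y (n 21 344 p i))))))) p)))))))))))))))))))))))))))))))))))) p)))))))))))))) (z (y
  (n 1 6 (z (x (y (n 6 1 (z (y (n 1 6 (z (x (y (n 6 1 p (z (x (y (n 1 1 (z (y (n 1 1 (z (y (n 1 2
  p p))) p))) (z (y (n 1 1 (z (y (n 1 2 p p))) (z (x (y (n 1 1 p p))))))))))))))) (z (y (n 1 6 p
  p)))))) (z (x (y (n 6 1 (z (x (y (n 1 6 (z (y (n 1 1 p (z (x (y (n 1 1 (z (x (y (n 1 1 (z (y (n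
  1 2 p p))) p)))) (z (x (y (n 1 1 (z (y (n 1 2 p p))) p))))))))))) p)))) (n 1 1 (z (y (n 1 1 p (z
  (x (y (n 1 1 p (z (x (y (n 1 2 p (z (x (y (n 1 2 p (z (y (n 1 4 p (z (x (y (n 1 2 p (z (x (y (n
  1 4 p (z (x (y (n 1 8 p (z (x (y (n 1 4 p (n 344 21 (z (x (y (n 21 344 p (z (x (y (n 21 688 p
  i)))))))) p))))))))))))))))))))))))))))))))))) (z (x (y (n 1 1 p p))))))))))))) (z (x (y (n 1 1
  (z (y (n 1 6 (z (y (n 6 1 p (z (x (y (n 6 1 p (n 1 1 (z (y (n 1 1 p (z (x (y (n 1 1 p p)))))))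
  p)))))))) p))) (z (y (n 1 6 (z (y (n 6 1 (z (y (n 1 6 (z (x (y (n 6 1 p (n 1 1 (z (y (n 1 1 p (z
  (x (y (n 1 1 p p))))))) p))))) p))) (z (x (y (n 6 1 (z (x (y (n 1 6 (z (y (n 1 1 p (z (y (n 1 1
  p (z (x (y (n 1 1 p p)))))))))) p)))) (n 1 1 (z (y (n 1 1 (z (x (y (n 1 1 p p)))) p))) (z (x (y
  (n 1 1 (z (x (y (n 1 1 p p)))) p)))))))))))) (z (x (y (n 1 1 (y (z (x (y (n 6 1 p (z (x (y (n 6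
  1 p (z (x (y (n 6 1 p (z (y (n 1 1 p (z (y (n 1 1 p (z (x (y (n 1 1 p p)))))))))))))))))))))))
  (z (y (n 1 6 (z (x (y (n 6 1 p (z (x (y (n 6 1 p (n 1 1 (z (y (n 1 1 p p))) p)))))))))
  p)))))))))))))))))))) (z (x (y (n 6 1 (z (y (n 1 6 (z (x (y (n 6 1 (z (x (y (n 1 6 (z (y (n 1 1
  p (y (z (x (y (n 1 1 (z (x (y (n 1 1 (z (y (n 1 2 p p))) p)))) (z (x (y (n 1 1 (z (y (n 1 2 p (z
  (x (y (n 1 2 p (z (x (y (n 1 2 p p))))))))))) p)))))))))))) (z (x (y (n 1 6 p p)))))))) (n 1 1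
  (z (x (y (n 1 1 p (z (x (y (n 1 1 p (z (x (y (n 1 2 p (z (y (n 1 2 p (z (x (y (n 1 2 (y (n 7 57
  p (z (x (y (n 7 57 p (z (x (y (n 10 3 p i)))))))))) (z (x (y (n 1 4 (y (n 94 17 (z (x (y (n 7 57
  p (z (x (y (n 7 57 p i)))))))) p)) (z (x (y (n 1 4 (x (y (n 94 17 (z (y (n 7 57 p (z (x (y (n 17
  94 p i))))))) p))) (z (x (y (n 1 4 (y (n 5 11 (z (y (n 94 17 (z (x (y (n 17 94 p i)))) p))) (z
  (x (y (n 5 11 (z (x (y (n 94 17 i p)))) i)))))) (z (y (n 21 344 (z (y (n 11 5 (z (x (y (n 5 11 p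
  i)))) p))) (z (x (y (n 21 344 (z (x (y (n 11 5 i p)))) i))))))))))))))))))))))))))))))))))))))
  p))))) (z (y (n 1 6 (z (x (y (n 6 1 p (x (y (n 1 1 (z (y (n 1 1 (z (x (y (n 1 1 (z (y (n 1 2 p
  p))) (z (x (y (n 1 2 p p)))))))) (z (x (y (n 1 1 (z (y (n 1 2 p p))) p))))))) (z (y (n 1 1 (z (x
  (y (n 1 1 p (z (x (y (n 1 2 p (z (x (y (n 1 2 p p)))))))))))) p)))))))))) (z (x (y (n 1 1 (z (x
  (y (n 1 6 (z (y (n 6 1 p p))) p)))) (z (x (y (n 1 6 (z (y (n 6 1 p p))) p)))))))))))))) (z (x (y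
  (n 6 1 (z (x (y (n 1 6 (z (y (n 1 1 p (z (y (n 1 1 p (z (x (y (n 1 1 p (z (x (y (n 1 2 p (z (x
  (y (n 1 2 p (z (x (y (n 1 2 (n 10 3 (z (x (y (n 25 78 (z (x (y (n 1 15 p i)))) p)))) (z (y (n 7
  57 (z (x (y (n 15 1 i p)))) i)))) (z (x (y (n 1 4 (x (y (n 18 55 (z (x (y (n 57 7 i (z (x (y (n
  15 1 i p)))))))) i))) (z (x (y (n 1 4 (x (y (n 94 17 (z (y (n 7 57 (z (x (y (n 55 18 i p))))
  i))) (z (x (y (n 45 19 (z (x (y (n 18 55 p i)))) p))))))) (z (x (y (n 1 4 (y (n 5 11 (z (y (n 94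
  17 i (z (x (y (n 45 19 i p))))))) i)) (z (y (n 21 344 (z (y (n 11 5 i (z (x (y (n 45 19 i
  p))))))) i))))))))))))))))))))))))))))))))))))) (z (x (y (n 1 6 (z (y (n 1 1 p (z (x (y (n 1 1
  (z (x (y (n 1 1 (z (y (n 1 2 p p))) p)))) (z (x (y (n 1 1 (z (y (n 1 2 p p))) (z (x (y (n 1 2 p
  (z (x (y (n 1 2 p (z (x (y (n 1 2 p p))))))))))))))))))))))) p)))))))) (n 1 1 (z (y (n 1 1 (z (x
  (y (n 1 1 (n 6 13 i (z (x (y (n 1 15 i (z (x (y (n 1 15 i p))))))))) (z (x (y (n 1 2 (y (n 102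
  13 (z (y (n 1 15 i (z (x (y (n 1 15 i p))))))) i)) (z (x (y (n 1 2 (x (y (n 102 13 (z (x (y (n
  13 102 i (z (x (y (n 1 15 i p)))))))) i))) (y (z (x (y (n 2 1 (z (x (y (n 2 1 (z (y (n 1 8 (z (x
  (y (n 2 1 (x (y (n 68 47 (z (y (n 45 19 (z (x (y (n 19 180 p i)))) p))) (z (x (y (n 9 23 (z (x
  (y (n 180 19 i p)))) i))))))) (z (x (y (n 6 13 (z (y (n 47 68 (z (x (y (n 9 23 p i)))) p))) (z
  (x (y (n 13 102 (z (x (y (n 23 9 i p)))) i)))))))))))) (y (z (x (y (n 45 19 (z (x (y (n 20 27 p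
  (z (x (y (n 19 180 p i)))))))) p)))))))) (z (x (y (n 1 2 (y (n 6 13 (z (x (y (n 13 6 i (z (x (y
  (n 45 19 i p)))))))) i)) (z (x (y (n 25 156 (z (x (y (n 6 13 (z (x (y (n 13 6 i p)))) i)))) (z
  (y (n 25 156 (z (x (y (n 6 13 p i)))) p))))))))))))))) (z (x (y (n 4 1 (z (y (n 1 8 (z (x (y (n
  2 1 (y (n 9 23 (z (y (n 180 19 (z (x (y (n 5 22 p i)))) p))) (z (x (y (n 18 23 (z (x (y (n 22 5
  i p)))) i)))))) (z (y (n 13 102 (z (y (n 23 9 (z (x (y (n 18 23 p i)))) p))) (z (x (y (n 7 25 (z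
  (x (y (n 23 18 i p)))) i))))))))))) (x (y (n 180 19 (z (y (n 20 27 p (z (x (y (n 5 22 p i)))))))
  p)))))) (z (x (y (n 1 1 (z (x (y (n 1 2 (z (x (y (n 7 25 (z (x (y (n 45 19 i (z (x (y (n 23 18 i
  p)))))))) i)))) (x (y (n 18 23 (z (x (y (n 45 19 i (z (x (y (n 22 5 i p)))))))) i))))))) (z (x
  (y (n 1 2 (z (x (y (n 7 25 (z (y (n 47 34 i (z (x (y (n 45 19 i p))))))) i)))) (x (y (n 34 47 (z
  (y (n 6 1 i (z (x (y (n 45 19 i p))))))) i)))))))))))))))))))))))))))))))) i))) (z (x (y (n 1 1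
  (z (y (n 1 2 (z (x (y (n 2 1 (z (y (n 1 4 (z (x (y (n 6 1 (z (y (n 5 12 i (z (x (y (n 33 62 i
  p))))))) i)))) (z (x (y (n 1 2 (y (n 53 22 (z (y (n 12 5 (z (x (y (n 33 62 i p)))) i))) (z (x (y
  (n 49 15 (z (x (y (n 62 33 p i)))) p)))))) (z (x (y (n 1 4 (z (x (y (n 1 2 (z (y (n 7 25 (z (y
  (n 47 34 (z (x (y (n 28 25 p i)))) p))) (z (x (y (n 22 53 (z (x (y (n 25 28 i p)))) i))))))) (y
  (n 34 47 (z (y (n 6 1 (z (x (y (n 15 49 p i)))) p))) (z (x (y (n 28 25 (z (x (y (n 49 15 i p))))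
  i)))))))))) (z (x (y (n 29 24 (z (x (y (n 22 53 p (z (x (y (n 7 25 p i)))))))) p)))))))))))))))
  (y (z (x (y (n 6 1 (z (y (n 33 62 i (z (x (y (n 7 25 i p))))))) i))))))))) (z (x (y (n 1 1 (z (y
  (n 1 4 (y (n 156 25 (z (y (n 3 58 (z (x (y (n 6 1 p i)))) p))) (z (x (y (n 12 5 (z (x (y (n 1 6
  i p)))) i)))))) (y (n 156 25 p (z (y (n 24 29 p (z (x (y (n 12 5 p i)))))))))))) (n 6 13 (z (x
  (y (n 39 50 (z (x (y (n 1 6 i p)))) i)))) (z (y (n 3 58 (z (x (y (n 6 1 p i)))) p))))))))))) (z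
  (x (y (n 1 1 (z (x (y (n 1 2 (x (y (n 62 33 (z (y (n 7 25 (z (x (y (n 15 17 p i)))) p))) (z (x
  (y (n 14 57 (z (x (y (n 17 15 i p)))) i))))))) (x (y (n 62 33 p (z (y (n 4 7 p (z (x (y (n 14 57
  p i)))))))))))))) (x (y (n 1 1 (y (z (x (y (n 1 2 (z (x (y (n 7 25 (z (x (y (n 15 2 p (z (x (y
  (n 1 2 p i)))))))) p)))) (x (y (n 2 1 (z (x (y (n 15 2 p (z (x (y (n 42 43 p i)))))))) p))))))))
  p)))))))))))))))))))))))

/-- coefficients of the polynomial part of the Fourier transform -/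
def cQ : List (List (List Int)) :=
  [[[1000000000000, 258577762187, -117111682597, 7804633941, -715105052, 195015323, -12721016, 235690], [258577762187, -56866746142, 33766536677, -9869708307, 963337658, -28809632, 233648], [-117111682597, 33766536677, -25230812363, 5547540952, -337392301, 5164264], [7804633941, -9869708307, 5547540952, -818650825, 26588343], [-715105052, 963337658, -337392301, 26588343], [195015323, -28809632, 5164264], [-12721016, 233648], [235690]],
  [[258577762187, -56866746142, 33766536677, -9869708307, 963337658, -28809632, 233648], [-56866746142, 37531458228, -19719801632, 2775579083, -122586410, 2787254], [33766536677, -19719801632, 6544702058, -578895054, 6753641], [-9869708307, 2775579083, -578895054, 36993292], [963337658, -122586410, 6753641], [-28809632, 2787254], [233648]],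
  [[-117111682597, 33766536677, -25230812363, 5547540952, -337392301, 5164264], [33766536677, -19719801632, 6544702058, -578895054, 6753641], [-25230812363, 6544702058, -1134465087, 45853201], [5547540952, -578895054, 45853201], [-337392301, 6753641], [5164264]],
  [[7804633941, -9869708307, 5547540952, -818650825, 26588343], [-9869708307, 2775579083, -578895054, 36993292], [5547540952, -578895054, 45853201], [-818650825, 36993292], [26588343]],
  [[-715105052, 963337658, -337392301, 26588343], [963337658, -122586410, 6753641], [-337392301, 6753641], [26588343]],
  [[195015323, -28809632, 5164264], [-28809632, 2787254], [5164264]],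
  [[-12721016, 233648], [233648]],
  [[235690]]]

/-- coefficients of minus the polynomial part of the auxiliary function -/
def cP : List (List (List Int)) :=
  [[[-1072209372649, -12633033765, -54708060847, 12794076059, -25284399, 70200447, -9194070, 235690], [-12633033765, -58498882682, 31161595638, -6781372223, 643967196, -20383974, 233648], [-54708060847, 31161595638, -17084699454, 4127602436, -300578365, 5164264], [12794076059, -6781372223, 4127602436, -707289675, 26588343], [-25284399, 643967196, -300578365, 26588343], [70200447, -20383974, 5164264], [-9194070, 233648], [235690]],
  [[-12633033765, -58498882682, 31161595638, -6781372223, 643967196, -20383974, 233648], [-58498882682, 15997887579, -8499240637, 1401723867, -83883712, 2787254], [31161595638, -8499240637, 3848050061, -440225480, 6753641], [-6781372223, 1401723867, -440225480, 36993292], [643967196, -83883712, 6753641], [-20383974, 2787254], [233648]],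
  [[-54708060847, 31161595638, -17084699454, 4127602436, -300578365, 5164264], [31161595638, -8499240637, 3848050061, -440225480, 6753641], [-17084699454, 3848050061, -928928958, 45853201], [4127602436, -440225480, 45853201], [-300578365, 6753641], [5164264]],
  [[12794076059, -6781372223, 4127602436, -707289675, 26588343], [-6781372223, 1401723867, -440225480, 36993292], [4127602436, -440225480, 45853201], [-707289675, 36993292], [26588343]],
  [[-25284399, 643967196, -300578365, 26588343], [643967196, -83883712, 6753641], [-300578365, 6753641], [26588343]],
  [[70200447, -20383974, 5164264], [-20383974, 2787254], [5164264]],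
  [[-9194070, 233648], [233648]],
  [[235690]]]

end SB

namespace SB
noncomputable def sumL {α : Type} (val : ℕ → α → ℝ) : ℕ → List α → ℝ
  | _, [] => 0
  | n, a :: as => val n a + sumL val (n + 1) as

noncomputable def S3 (G : List (List (List Int))) (u : ℕ → ℕ → ℕ → ℝ) : ℝ :=
  sumL (fun i T => sumL (fun j r => sumL (fun k (c : Int) => (c : ℝ) * u i j k) 0 r) 0 T) 0 G

noncomputable def gp (a : ℕ) (t : ℝ) : ℝ := match a with
  | 0 => 1
  | 1 => 1 - t
  | 2 => t^2-6*t+3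
  | 3 => -(t^3-15*t^2+45*t-15)
  | 4 => t^4-28*t^3+210*t^2-420*t+105
  | 5 => -(t^5-45*t^4+630*t^3-3150*t^2+4725*t-945)
  | 6 => t^6-66*t^5+1485*t^4-13860*t^3+51975*t^2-62370*t+10395
  | 7 => -(t^7-91*t^6+3003*t^5-45045*t^4+315315*t^3-945945*t^2+945945*t-135135)
  | _ => 0

theorem gp_eq (a : ℕ) (h : a < 8) (x : ℝ) : (-1) ^ a * He (2 * a) x = gp a (x ^ 2) := by
  interval_cases a <;> simp [He, gp] <;> ring

set_option maxRecDepth 100000 in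
set_option maxHeartbeats 4000000 in
theorem P_id (x y z : ℝ) : S3 cQ (fun i j k => gp i x * gp j y * gp k z) = - evQ cP x y z 1 := by
  simp only [S3, cQ, cP, sumL, evQ, evT, evL, evB, gp, List.length, one_pow]
  push_cast
  ring
end SB

namespace SB

abbrev R3 := Fin 3 → ℝ

theorem sumL_int {α Ω : Type} [MeasurableSpace Ω] {μ : Measure Ω} (val : ℕ → α → Ω → ℝ)
    (l : List α) : ∀ (n : ℕ), (∀ i, ∀ a ∈ l, Integrable (val i a) μ) →
    Integrable (fun ω => sumL (fun i a => val i a ω) n l) μ ∧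
      ∫ ω, sumL (fun i a => val i a ω) n l ∂μ = sumL (fun i a => ∫ ω, val i a ω ∂μ) n l := by
  induction l with
  | nil => intro n h; simp [sumL]
  | cons a as ih =>
    intro n h
    have h1 := ih (n + 1) (fun i b hb => h i b (by simp [hb]))
    have h2 := h n a (by simp)
    refine ⟨h2.add h1.1, ?_⟩
    simp only [sumL]
    rw [integral_add h2 h1.1, h1.2]

theorem S3_int {Ω : Type} [MeasurableSpace Ω] {μ : Measure Ω} (G : List (List (List Int)))
    (u : ℕ → ℕ → ℕ → Ω → ℝ) (h : ∀ i j k, Integrable (u i j k) μ) :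
    Integrable (fun ω => S3 G (fun i j k => u i j k ω)) μ ∧
      ∫ ω, S3 G (fun i j k => u i j k ω) ∂μ = S3 G (fun i j k => ∫ ω, u i j k ω ∂μ) := by
  have h3 := fun i j (r : List Int) => sumL_int (fun k (c : Int) ω => (c : ℝ) * u i j k ω) r 0
    (fun k c _ => (h i j k).const_mul (c : ℝ))
  have h2 := fun i (T : List (List Int)) => sumL_int
    (fun j (r : List Int) ω => sumL (fun k (c : Int) => (c : ℝ) * u i j k ω) 0 r) T 0
    (fun j r _ => (h3 i j r).1)
  have h1 := sumL_int (fun i (T : List (List Int)) ω =>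
    sumL (fun j (r : List Int) => sumL (fun k (c : Int) => (c : ℝ) * u i j k ω) 0 r) 0 T) G 0
    (fun i T _ => (h2 i T).1)
  refine ⟨h1.1, ?_⟩
  unfold S3
  rw [h1.2]
  simp only [(h2 _ _).2, (h3 _ _ _).2, integral_const_mul]

theorem sumL_mul {α : Type} (val : ℕ → α → ℝ) (c : ℝ) (l : List α) : ∀ n,
    sumL val n l * c = sumL (fun i a => val i a * c) n l := by
  induction l with
  | nil => intro n; simp [sumL]
  | cons a as ih => intro n; simp only [sumL, add_mul, ih]

theorem S3_mul (G : List (List (List Int))) (u : ℕ → ℕ → ℕ → ℝ) (c : ℝ) :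
    S3 G u * c = S3 G (fun i j k => u i j k * c) := by
  unfold S3
  simp only [sumL_mul, mul_assoc]

theorem sumL_pow {α : Type} (val : α → ℝ) (x : ℝ) (l : List α) : ∀ n,
    sumL (fun i a => val a * x ^ i) n l = evL val l x * x ^ n := by
  induction l with
  | nil => intro n; simp [sumL, evL]
  | cons a as ih => intro n; simp only [sumL, ih, evL, pow_succ]; ring

theorem evB_one (x : ℝ) (l : List Int) : evB l x 1 = evL (fun c : Int => (c : ℝ)) l x := by
  induction l with
  | nil => simp [evB, evL]
  | cons a as ih => simp [evB, evL, ih]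

theorem S3_pow (G : List (List (List Int))) (x y z : ℝ) :
    S3 G (fun i j k => x ^ i * y ^ j * z ^ k) = evQ G x y z 1 := by
  unfold S3 evQ evT
  have e1 : ∀ (i j : ℕ) (r : List Int), sumL (fun k (c : Int) => (c : ℝ) * (x ^ i * y ^ j * z ^ k)) 0 r
      = evB r z 1 * y ^ j * x ^ i := by
    intro i j r
    have := sumL_pow (fun c : Int => (c : ℝ)) z r 0
    rw [pow_zero, mul_one] at this
    rw [evB_one, ← this, sumL_mul, sumL_mul]
    congr 1; funext k c; ring
  have e2 : ∀ (i : ℕ) (T : List (List Int)), sumL (fun j r => evB r z 1 * y ^ j * x ^ i) 0 T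
      = evL (fun r => evB r z 1) T y * x ^ i := by
    intro i T
    have := sumL_pow (fun r => evB r z 1) y T 0
    rw [pow_zero, mul_one] at this
    rw [← this, sumL_mul]
  simp only [e1, e2]
  simpa using sumL_pow (fun T => evL (fun r => evB r z 1) T y) x G 0

/-- one-dimensional transform -/
noncomputable def gg (a : ℕ) (x : ℝ) : ℝ :=
  √(2 * Real.pi) * ((-1) ^ a * He (2 * a) x * Real.exp (-x ^ 2 / 2))

theorem fi_even (a : ℕ) (x : ℝ) : fi (2 * a) x = (gg a x : ℂ) := by
  rw [fi_eq, pow_mul, Complex.I_sq, gg]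
  push_cast; ring

theorem mono_int (i j k : ℕ) : Integrable (fun ξ : R3 => hx (2 * i) (ξ 0) * hx (2 * j) (ξ 1) * hx (2 * k) (ξ 2)) := by
  have := Integrable.fintype_prod (f := fun (m : Fin 3) (v : ℝ) => hx (2 * (![i, j, k] m)) v)
    (μ := fun _ => volume) (fun m => hx_int _)
  simp only [Fin.prod_univ_three] at this
  exact this

theorem mono_fourier (i j k : ℕ) (x : R3) :
    ∫ ξ : R3, hx (2 * i) (ξ 0) * hx (2 * j) (ξ 1) * hx (2 * k) (ξ 2) *
      Real.cos (x 0 * ξ 0 + x 1 * ξ 1 + x 2 * ξ 2) = gg i (x 0) * gg j (x 1) * gg k (x 2) := by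
  have key := integral_fintype_prod_volume_eq_prod (𝕜 := ℂ) (fun (m : Fin 3) (v : ℝ) =>
    ((hx (2 * (![i, j, k] m)) v : ℝ) : ℂ) * Complex.exp (Complex.I * (x m) * v))
  have e2 := Integrable.fintype_prod (𝕜 := ℂ) (f := fun (m : Fin 3) (v : ℝ) =>
    ((hx (2 * (![i, j, k] m)) v : ℝ) : ℂ) * Complex.exp (Complex.I * (x m) * v))
    (μ := fun _ => volume) (fun m => fi_int _ _)
  rw [← volume_pi] at e2
  have e1 : ∀ m, ∫ v : ℝ, ((hx (2 * (![i, j, k] m)) v : ℝ) : ℂ) * Complex.exp (Complex.I * (x m) * v)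
      = (gg (![i, j, k] m) (x m) : ℂ) := fun m => fi_even _ _
  rw [Finset.prod_congr rfl (fun m _ => e1 m)] at key
  have e3 := congrArg Complex.re key
  rw [← Complex.reCLM_apply, ← ContinuousLinearMap.integral_comp_comm _ e2] at e3
  rw [← Complex.ofReal_prod, Complex.ofReal_re] at e3
  simp only [Fin.prod_univ_three, Matrix.cons_val_zero, Matrix.cons_val_one, Matrix.cons_val] at e3
  rw [← e3]
  congr 1; funext ξ
  have : ((hx (2 * i) (ξ 0) : ℝ) : ℂ) * Complex.exp (Complex.I * (x 0) * ξ 0) *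
      (((hx (2 * j) (ξ 1) : ℝ) : ℂ) * Complex.exp (Complex.I * (x 1) * ξ 1)) *
      (((hx (2 * k) (ξ 2) : ℝ) : ℂ) * Complex.exp (Complex.I * (x 2) * ξ 2)) =
      ((hx (2 * i) (ξ 0) * hx (2 * j) (ξ 1) * hx (2 * k) (ξ 2) : ℝ) : ℂ) *
      Complex.exp (((x 0 * ξ 0 + x 1 * ξ 1 + x 2 * ξ 2 : ℝ) : ℂ) * Complex.I) := by
    have : (((x 0 * ξ 0 + x 1 * ξ 1 + x 2 * ξ 2 : ℝ) : ℂ) * Complex.I) =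
      Complex.I * (x 0) * ξ 0 + Complex.I * (x 1) * ξ 1 + Complex.I * (x 2) * ξ 2 := by
      push_cast; ring
    rw [this, Complex.exp_add, Complex.exp_add]
    push_cast; ring
  rw [this, Complex.reCLM_apply, Complex.re_ofReal_mul, Complex.exp_ofReal_mul_I_re]

noncomputable def FF (ξ : R3) : ℝ :=
  S3 cQ (fun i j k => hx (2 * i) (ξ 0) * hx (2 * j) (ξ 1) * hx (2 * k) (ξ 2))

noncomputable def Ph (x : R3) : ℝ :=
  S3 cQ (fun i j k => gg i (x 0) * gg j (x 1) * gg k (x 2))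

theorem FF_int : Integrable FF := (S3_int cQ _ mono_int).1

theorem Ph_eq (x : R3) : Ph x = ∫ ξ : R3, FF ξ * Real.cos (x 0 * ξ 0 + x 1 * ξ 1 + x 2 * ξ 2) := by
  unfold Ph FF
  simp only [S3_mul]
  rw [(S3_int cQ (fun i j k (ξ : R3) => hx (2 * i) (ξ 0) * hx (2 * j) (ξ 1) * hx (2 * k) (ξ 2) *
      Real.cos (x 0 * ξ 0 + x 1 * ξ 1 + x 2 * ξ 2)) ?_).2]
  · simp only [mono_fourier]
  · intro i j k
    refine (mono_int i j k).mul_bdd (c := 1) ?_ ?_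
    · exact Continuous.aestronglyMeasurable (by fun_prop)
    · exact Filter.Eventually.of_forall fun ξ => by simpa using Real.abs_cos_le_one _

theorem FF_eq (ξ : R3) : FF ξ = evQ cQ (ξ 0 ^ 2) (ξ 1 ^ 2) (ξ 2 ^ 2) 1 *
    Real.exp (-(ξ 0 ^ 2 + ξ 1 ^ 2 + ξ 2 ^ 2) / 2) := by
  rw [← S3_pow, S3_mul, FF]
  congr 1; funext i j k
  have : -(ξ 0 ^ 2 + ξ 1 ^ 2 + ξ 2 ^ 2) / 2 = -ξ 0 ^ 2 / 2 + -ξ 1 ^ 2 / 2 + -ξ 2 ^ 2 / 2 := by ring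
  rw [this, Real.exp_add, Real.exp_add]
  simp only [hx, pow_mul]
  ring

theorem gg_cont (a : ℕ) : Continuous (gg a) := by
  have := He_cont (2 * a); unfold gg; fun_prop

theorem gg_int (a : ℕ) (s : ℝ) (hs : s ≠ 0) : Integrable (fun x => gg a (s * x)) := by
  have : Integrable (gg a) := by
    unfold gg
    have := ((He_int (2 * a)).1.const_mul ((-1) ^ a)).const_mul √(2 * Real.pi)
    simpa only [mul_assoc] using this
  exact this.comp_mul_left' hs

theorem gg_integral (a : ℕ) (s : ℝ) (hs : 0 < s) :
    ∫ x, gg a (s * x) = if a = 0 then 2 * Real.pi / s else 0 := by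
  rw [Measure.integral_comp_mul_left]
  unfold gg
  simp only [mul_assoc, integral_const_mul]
  split_ifs with h
  · subst h
    have := He_integral_zero
    simp only [mul_zero, pow_zero, one_mul, this]
    rw [Real.mul_self_sqrt (by positivity), abs_of_pos (by positivity), smul_eq_mul]
    field_simp
  · obtain ⟨n, rfl⟩ := Nat.exists_eq_succ_of_ne_zero h
    rw [show 2 * (n.succ) = (2 * n + 1) + 1 by omega, He_integral]
    simp

theorem Phs_int (s : ℝ) (hs : 0 < s) : Integrable (fun x : R3 => Ph (s • x)) ∧
    ∫ x : R3, Ph (s • x) = S3 cQ (fun i j k => (if i = 0 then 2 * Real.pi / s else 0) *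
      (if j = 0 then 2 * Real.pi / s else 0) * (if k = 0 then 2 * Real.pi / s else 0)) := by
  have h1 : ∀ i j k : ℕ, Integrable (fun x : R3 => gg i (s * x 0) * gg j (s * x 1) * gg k (s * x 2)) := by
    intro i j k
    have := Integrable.fintype_prod (f := fun (m : Fin 3) (v : ℝ) => gg (![i, j, k] m) (s * v))
      (μ := fun _ => volume) (fun m => gg_int _ s hs.ne')
    simp only [Fin.prod_univ_three] at this
    exact this
  have h2 : ∀ i j k : ℕ, ∫ x : R3, gg i (s * x 0) * gg j (s * x 1) * gg k (s * x 2)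
      = (if i = 0 then 2 * Real.pi / s else 0) *
      (if j = 0 then 2 * Real.pi / s else 0) * (if k = 0 then 2 * Real.pi / s else 0) := by
    intro i j k
    have := integral_fintype_prod_volume_eq_prod (𝕜 := ℝ)
      (fun (m : Fin 3) (v : ℝ) => gg (![i, j, k] m) (s * v))
    simp only [Fin.prod_univ_three, gg_integral _ s hs] at this
    exact this
  have := S3_int cQ _ h1
  simp only [h2] at this
  simpa [Ph] using this

theorem sumL_congr {α : Type} (val val' : ℕ → α → ℝ) (N : ℕ) (l : List α) : ∀ n, n + l.length ≤ N →
    (∀ i < N, ∀ a ∈ l, val i a = val' i a) → sumL val n l = sumL val' n l := by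
  induction l with
  | nil => intro n _ _; simp [sumL]
  | cons a as ih =>
    intro n hn h
    simp only [List.length_cons] at hn
    simp only [sumL]
    rw [h n (by omega) a (by simp), ih (n + 1) (by omega) (fun i hi b hb => h i hi b (by simp [hb]))]

theorem S3_congr (u v : ℕ → ℕ → ℕ → ℝ) (h : ∀ i < 8, ∀ j < 8, ∀ k < 8, u i j k = v i j k) :
    S3 cQ u = S3 cQ v := by
  have hl : cQ.length ≤ 8 ∧ (∀ T ∈ cQ, T.length ≤ 8) ∧ (∀ T ∈ cQ, ∀ r ∈ T, r.length ≤ 8) := by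
    decide
  unfold S3
  refine sumL_congr _ _ 8 _ _ (by simpa using hl.1) (fun i hi T hT => ?_)
  refine sumL_congr _ _ 8 _ _ (by simpa using hl.2.1 T hT) (fun j hj r hr => ?_)
  refine sumL_congr _ _ 8 _ _ (by simpa using hl.2.2 T hT r hr) (fun k hk c _ => ?_)
  rw [h i hi j hj k hk]

theorem Ph_poly (x : R3) : Ph x = - (√(2 * Real.pi) ^ 3 * evQ cP (x 0 ^ 2) (x 1 ^ 2) (x 2 ^ 2) 1 *
    Real.exp (-(x 0 ^ 2 + x 1 ^ 2 + x 2 ^ 2) / 2)) := by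
  have e : -(x 0 ^ 2 + x 1 ^ 2 + x 2 ^ 2) / 2 = -x 0 ^ 2 / 2 + -x 1 ^ 2 / 2 + -x 2 ^ 2 / 2 := by ring
  have : - (√(2 * Real.pi) ^ 3 * evQ cP (x 0 ^ 2) (x 1 ^ 2) (x 2 ^ 2) 1 *
    Real.exp (-(x 0 ^ 2 + x 1 ^ 2 + x 2 ^ 2) / 2)) =
    S3 cQ (fun i j k => gp i (x 0 ^ 2) * gp j (x 1 ^ 2) * gp k (x 2 ^ 2)) *
      (√(2 * Real.pi) ^ 3 * Real.exp (-(x 0 ^ 2 + x 1 ^ 2 + x 2 ^ 2) / 2)) := by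
    rw [P_id]; ring
  rw [this, S3_mul, Ph]
  refine S3_congr _ _ (fun i hi j hj k hk => ?_)
  rw [← gp_eq i hi, ← gp_eq j hj, ← gp_eq k hk, e, Real.exp_add, Real.exp_add]
  unfold gg
  ring

theorem Ph_cont : Continuous Ph := by
  have e : Ph = fun x => S3 cQ (fun i j k => gg i (x 0) * gg j (x 1) * gg k (x 2)) := rfl
  have h : ∀ {α : Type} (val : ℕ → α → R3 → ℝ) (hv : ∀ i a, Continuous (val i a)) (l : List α) (n : ℕ),
      Continuous (fun x => sumL (fun i a => val i a x) n l) := by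
    intro α val hv l
    induction l with
    | nil => intro n; simp only [sumL]; fun_prop
    | cons a as ih => intro n; simp only [sumL]; exact (hv n a).add (ih (n + 1))
  rw [e]
  unfold S3
  refine h (fun i T x => _) (fun i T => h (fun j r x => _) (fun j r => h (fun k c x => _) (fun k c => ?_) _ _) _ _) _ _
  have h1 := gg_cont i
  have h2 := gg_cont j
  have h3 := gg_cont k
  fun_prop
end SB

namespace SB
set_option maxRecDepth 100000 in
theorem fullQ : full 0 treeQ cQ = true := by decide +kernel
set_option maxRecDepth 100000 in
theorem fullP : full 3125 treeP cP = true := by decide +kernel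
end SB

namespace SB

theorem sym_nonneg (ρ : ℕ) (T : Tr) (G : List (List (List Int))) (h : full ρ T G = true)
    (hs : shp G = true) (h0 : sw0 G = G) (h1 : sw1 G = G)
    (a b c : ℝ) (ha : 0 ≤ a) (hb : 0 ≤ b) (hc : 0 ≤ c)
    (hI : ¬ (32 * (hf a + hf b + hf c) < ρ)) : 0 ≤ evQ G a b c 1 := by
  have s0 : ∀ a b c : ℝ, evQ G a b c 1 = evQ G b a c 1 := by
    intro a b c
    conv_lhs => rw [← h0]
    exact evQ_sw0 _ _ _ _ _
  have s1 : ∀ a b c : ℝ, evQ G a b c 1 = evQ G a c b 1 := by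
    intro a b c
    conv_lhs => rw [← h1]
    exact evQ_sw1 _ hs _ _ _ _
  have key : ∀ a b c : ℝ, b ≤ a → c ≤ b → 0 ≤ c → ¬ (32 * (hf a + hf b + hf c) < ρ) →
      0 ≤ evQ G a b c 1 := by
    intro a b c hab hbc hc hI
    refine full_sound ρ T G h a b c hab hbc hc ?_
    intro hh
    apply hI
    simpa using hh.2.2.2.2
  rcases le_total a b with hab | hab <;> rcases le_total b c with hbc | hbc <;>
    rcases le_total a c with hac | hac
  · rw [s1, s0, s1]; exact key c b a hbc hab ha (by intro hh; apply hI; linarith)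
  · rw [s1, s0, s1]; exact key c b a hbc hab ha (by intro hh; apply hI; linarith)
  · rw [s0, s1]; exact key b c a hbc hac ha (by intro hh; apply hI; linarith)
  · rw [s0]; exact key b a c hab hac hc (by intro hh; apply hI; linarith)
  · rw [s1, s0]; exact key c a b hac hab hb (by intro hh; apply hI; linarith)
  · rw [s1]; exact key a c b hac hbc hb (by intro hh; apply hI; linarith)
  · exact key a b c hab hbc hc hI
  · exact key a b c hab hbc hc hI

theorem hf_sq (x : ℝ) : hf (x ^ 2) = |x| ^ 5 := by
  unfold hf
  rw [Real.sqrt_sq_eq_abs, ← sq_abs x]; ring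

theorem hf_nonneg (x : ℝ) : 0 ≤ hf x := by unfold hf; positivity

theorem FF_nonneg (ξ : R3) : 0 ≤ FF ξ := by
  rw [FF_eq]
  refine mul_nonneg (sym_nonneg 0 treeQ cQ fullQ (by decide +kernel) (by decide +kernel) (by decide +kernel) _ _ _
    (by positivity) (by positivity) (by positivity) ?_) (by positivity)
  have h1 := hf_nonneg (ξ 0 ^ 2)
  have h2 := hf_nonneg (ξ 1 ^ 2)
  have h3 := hf_nonneg (ξ 2 ^ 2)
  push_cast; linarith

theorem Ph_nonpos (x : R3) (h : 3125 ≤ 32 * (|x 0| ^ 5 + |x 1| ^ 5 + |x 2| ^ 5)) : Ph x ≤ 0 := by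
  rw [Ph_poly]
  have := sym_nonneg 3125 treeP cP fullP (by decide +kernel) (by decide +kernel) (by decide +kernel)
    (x 0 ^ 2) (x 1 ^ 2) (x 2 ^ 2)
    (by positivity) (by positivity) (by positivity) (by rw [hf_sq, hf_sq, hf_sq]; push_cast; linarith)
  have : 0 ≤ √(2 * Real.pi) ^ 3 * evQ cP (x 0 ^ 2) (x 1 ^ 2) (x 2 ^ 2) 1 *
    Real.exp (-(x 0 ^ 2 + x 1 ^ 2 + x 2 ^ 2) / 2) := by positivity
  linarith

theorem Ph_zero : Ph 0 = √(2 * Real.pi) ^ 3 * 1072209372649 := by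
  rw [Ph_poly]
  simp [evQ, evT, evL, evB, cP]

theorem Ph_integral (s : ℝ) (hs : 0 < s) : ∫ x : R3, Ph (s • x) =
    (2 * Real.pi / s) ^ 3 * 1000000000000 := by
  rw [(Phs_int s hs).2]
  simp [S3, sumL, cQ]
  ring
end SB

namespace SB

abbrev E3 := EuclideanSpace ℝ (Fin 3)

noncomputable def ph (s : ℝ) (x : E3) (ξ : R3) : ℝ := s * x 0 * ξ 0 + s * x 1 * ξ 1 + s * x 2 * ξ 2

theorem ph_sub (s : ℝ) (x y : E3) (ξ : R3) : ph s (x - y) ξ = ph s x ξ - ph s y ξ := by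
  simp only [ph, PiLp.sub_apply]; ring

theorem ph_cont (s : ℝ) : Continuous (fun p : E3 × R3 => ph s p.1 p.2) := by
  unfold ph; fun_prop

noncomputable def ff (s : ℝ) (z : E3) : ℝ := Ph (fun i => s * z i)

theorem ff_eq (s : ℝ) (z : E3) : ff s z = ∫ ξ, FF ξ * Real.cos (ph s z ξ) := Ph_eq _

theorem ff_cont (s : ℝ) : Continuous (ff s) := by
  unfold ff; have := Ph_cont; fun_prop

theorem ff_bdd (s : ℝ) (z : E3) : |ff s z| ≤ ∫ ξ, FF ξ := by
  rw [ff_eq]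
  rw [← Real.norm_eq_abs]
  refine (norm_integral_le_integral_norm (fun ξ => FF ξ * Real.cos (ph s z ξ))).trans ?_
  refine integral_mono_of_nonneg (Filter.Eventually.of_forall fun ξ => norm_nonneg _) FF_int
    (Filter.Eventually.of_forall fun ξ => ?_)
  simp only [Real.norm_eq_abs, abs_mul, abs_of_nonneg (FF_nonneg ξ)]
  exact mul_le_of_le_one_right (FF_nonneg ξ) (Real.abs_cos_le_one _)

noncomputable def BB (s : ℝ) (μ ν : Measure E3) : ℝ := ∫ p : E3 × E3, ff s (p.1 - p.2) ∂(μ.prod ν)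

theorem FF_prod_int (s : ℝ) (μ ν : Measure E3) [IsFiniteMeasure μ] [IsFiniteMeasure ν] :
    Integrable (Function.uncurry fun (p : E3 × E3) (ξ : R3) => FF ξ * Real.cos (ph s p.1 ξ - ph s p.2 ξ))
      ((μ.prod ν).prod volume) := by
  have h1 : Integrable (fun q : (E3 × E3) × R3 => FF q.2) ((μ.prod ν).prod volume) :=
    FF_int.comp_snd (μ.prod ν)
  refine h1.mul_bdd (c := 1) ?_ ?_
  · have := ph_cont s
    refine Continuous.aestronglyMeasurable ?_
    have a : Continuous (fun q : (E3 × E3) × R3 => ph s q.1.1 q.2) :=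
      this.comp (f := fun q : (E3 × E3) × R3 => (q.1.1, q.2)) (by fun_prop)
    have b : Continuous (fun q : (E3 × E3) × R3 => ph s q.1.2 q.2) :=
      this.comp (f := fun q : (E3 × E3) × R3 => (q.1.2, q.2)) (by fun_prop)
    fun_prop
  · exact Filter.Eventually.of_forall fun ξ => by simpa using Real.abs_cos_le_one _

theorem BB_eq (s : ℝ) (μ ν : Measure E3) [IsFiniteMeasure μ] [IsFiniteMeasure ν] :
    Integrable (fun ξ => FF ξ * ((∫ x, Real.cos (ph s x ξ) ∂μ) * (∫ x, Real.cos (ph s x ξ) ∂ν) +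
      (∫ x, Real.sin (ph s x ξ) ∂μ) * (∫ x, Real.sin (ph s x ξ) ∂ν))) ∧
    BB s μ ν = ∫ ξ, FF ξ * ((∫ x, Real.cos (ph s x ξ) ∂μ) * (∫ x, Real.cos (ph s x ξ) ∂ν) +
      (∫ x, Real.sin (ph s x ξ) ∂μ) * (∫ x, Real.sin (ph s x ξ) ∂ν)) := by
  have hi := FF_prod_int s μ ν
  have hc : ∀ ξ, Continuous (fun x => ph s x ξ) := fun ξ =>
    (ph_cont s).comp (f := fun x => (x, ξ)) (by fun_prop)
  have ic : ∀ (μ : Measure E3) [IsFiniteMeasure μ] ξ, Integrable (fun x => Real.cos (ph s x ξ)) μ := by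
    intro μ _ ξ
    have := hc ξ
    exact Integrable.of_bound (C := 1) (Continuous.aestronglyMeasurable (by fun_prop))
      (Filter.Eventually.of_forall fun ξ => by simpa using Real.abs_cos_le_one _)
  have is : ∀ (μ : Measure E3) [IsFiniteMeasure μ] ξ, Integrable (fun x => Real.sin (ph s x ξ)) μ := by
    intro μ _ ξ
    have := hc ξ
    exact Integrable.of_bound (C := 1) (Continuous.aestronglyMeasurable (by fun_prop))
      (Filter.Eventually.of_forall fun ξ => by simpa using Real.abs_sin_le_one _)
  have e : ∀ ξ, ∫ p : E3 × E3, FF ξ * Real.cos (ph s p.1 ξ - ph s p.2 ξ) ∂(μ.prod ν) =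
      FF ξ * ((∫ x, Real.cos (ph s x ξ) ∂μ) * (∫ x, Real.cos (ph s x ξ) ∂ν) +
      (∫ x, Real.sin (ph s x ξ) ∂μ) * (∫ x, Real.sin (ph s x ξ) ∂ν)) := by
    intro ξ
    rw [integral_const_mul]
    congr 1
    simp only [Real.cos_sub]
    rw [integral_add ((ic μ ξ).mul_prod (ic ν ξ)) ((is μ ξ).mul_prod (is ν ξ)),
      integral_prod_mul (fun x => Real.cos (ph s x ξ)) (fun x => Real.cos (ph s x ξ)),
      integral_prod_mul (fun x => Real.sin (ph s x ξ)) (fun x => Real.sin (ph s x ξ))]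
  constructor
  · refine hi.integral_prod_right.congr (Filter.Eventually.of_forall fun ξ => ?_)
    exact e ξ
  · unfold BB
    simp only [ff_eq, ph_sub]
    rw [integral_integral_swap hi]
    simp only [e]

theorem BB_pos (s θ : ℝ) (μ ν : Measure E3) [IsFiniteMeasure μ] [IsFiniteMeasure ν] :
    0 ≤ BB s μ μ - 2 * θ * BB s μ ν + θ ^ 2 * BB s ν ν := by
  have h1 := BB_eq s μ μ
  have h2 := BB_eq s μ ν
  have h3 := BB_eq s ν ν
  rw [h1.2, h2.2, h3.2, ← integral_const_mul, ← integral_const_mul,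
    ← integral_sub h1.1 (h2.1.const_mul _)]
  have h4 := h1.1.sub (h2.1.const_mul (2 * θ))
  have h5 := h3.1.const_mul (θ ^ 2)
  refine le_trans ?_ (integral_add h4 h5).le
  refine integral_nonneg fun ξ => ?_
  have : 0 ≤ FF ξ * (((∫ x, Real.cos (ph s x ξ) ∂μ) - θ * (∫ x, Real.cos (ph s x ξ) ∂ν)) ^ 2 +
    ((∫ x, Real.sin (ph s x ξ) ∂μ) - θ * (∫ x, Real.sin (ph s x ξ) ∂ν)) ^ 2) :=
    mul_nonneg (FF_nonneg ξ) (by positivity)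
  refine this.trans (le_of_eq ?_)
  simp only [Pi.sub_apply]
  ring

theorem BB_iter (s : ℝ) (μ ν : Measure E3) [IsFiniteMeasure μ] [IsFiniteMeasure ν] :
    BB s μ ν = ∫ x, ∫ y, ff s (x - y) ∂ν ∂μ ∧ Integrable (fun x => ∫ y, ff s (x - y) ∂ν) μ := by
  have h : Integrable (fun p : E3 × E3 => ff s (p.1 - p.2)) (μ.prod ν) := by
    have := ff_cont s
    exact Integrable.of_bound (C := ∫ ξ, FF ξ) (Continuous.aestronglyMeasurable (by fun_prop))
      (Filter.Eventually.of_forall fun ξ => ff_bdd _ _)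
  exact ⟨integral_prod _ h, h.integral_prod_left⟩

noncomputable def pts (S : Finset E3) : Measure E3 := ∑ x ∈ S, Measure.dirac x

instance (S : Finset E3) : IsFiniteMeasure (pts S) := by
  unfold pts; infer_instance

theorem integral_pts (S : Finset E3) (g : E3 → ℝ) : ∫ x, g x ∂(pts S) = ∑ x ∈ S, g x := by
  unfold pts
  rw [integral_finsetSum_measure]
  · simp
  · intro x _
    exact integrable_dirac (by simp)
end SB

namespace SB

theorem ff_int (s : ℝ) (hs : 0 < s) : Integrable (ff s) ∧ ∫ z, ff s z = (2 * Real.pi / s) ^ 3 * 1000000000000 := by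
  have h := EuclideanSpace.volume_preserving_symm_measurableEquiv_toLp (Fin 3)
  have e : ff s = (fun x : R3 => Ph (s • x)) ∘ (MeasurableEquiv.toLp 2 (Fin 3 → ℝ)).symm := by
    funext z; rfl
  constructor
  · rw [e]; exact (h.integrable_comp_emb (MeasurableEquiv.measurableEmbedding _)).2 (Phs_int s hs).1
  · rw [e, ← Ph_integral s hs]
    exact h.integral_comp (MeasurableEquiv.measurableEmbedding _) (fun x : R3 => Ph (s • x))

noncomputable def ep (s T : ℝ) : ℝ := ∫ z in (Metric.closedBall (0 : E3) T)ᶜ, |ff s z|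

theorem ep_nonneg (s T : ℝ) : 0 ≤ ep s T := integral_nonneg fun _ => abs_nonneg _

theorem ep_tendsto (s : ℝ) (hs : 0 < s) : Filter.Tendsto (ep s) Filter.atTop (nhds 0) := by
  have hi := (ff_int s hs).1.abs
  have h := (aecover_closedBall (μ := (volume : Measure E3)) (x := 0) Filter.tendsto_id).integral_tendsto_of_countably_generated hi
  have e : ep s = fun T => (∫ z, |ff s z|) - ∫ z in Metric.closedBall (0 : E3) (id T), |ff s z| := by
    funext T
    have := integral_add_compl (μ := (volume : Measure E3)) (s := Metric.closedBall (0 : E3) T) Metric.isClosed_closedBall.measurableSet hi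
    unfold ep
    rw [← this]; simp
  rw [e]
  simpa using h.const_sub (∫ z, |ff s z|)

theorem g_near (s : ℝ) (hs : 0 < s) (x : E3) (T : ℝ) (D : Set E3) (hD : MeasurableSet D)
    (h : Metric.closedBall x T ⊆ D) :
    |(∫ y in D, ff s (x - y)) - ∫ z, ff s z| ≤ ep s T := by
  have hi : Integrable (fun y => ff s (x - y)) := (ff_int s hs).1.comp_sub_left x
  rw [← integral_sub_left_eq_self (ff s) volume x, ← integral_add_compl hD hi]
  have : ∀ a b : ℝ, a - (a + b) = -b := by intros; ring
  rw [this, abs_neg, ← Real.norm_eq_abs]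
  refine (norm_integral_le_integral_norm _).trans ?_
  have h2 : ∫ y in Dᶜ, ‖ff s (x - y)‖ ≤ ∫ y in (Metric.closedBall x T)ᶜ, ‖ff s (x - y)‖ := by
    refine setIntegral_mono_set hi.norm.integrableOn (Filter.Eventually.of_forall fun _ => norm_nonneg _) ?_
    exact (Set.compl_subset_compl.2 h).eventuallyLE
  refine h2.trans (le_of_eq ?_)
  unfold ep
  rw [← integral_indicator Metric.isClosed_closedBall.measurableSet.compl,
    ← integral_indicator Metric.isClosed_closedBall.measurableSet.compl]
  refine Eq.trans ?_ (integral_sub_left_eq_self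
    (Set.indicator (Metric.closedBall (0 : E3) T)ᶜ (fun z => |ff s z|)) volume x)
  congr 1
  funext y
  by_cases hy : dist y x ≤ T
  · rw [Set.indicator_of_notMem, Set.indicator_of_notMem]
    · simpa [dist_eq_norm, norm_sub_rev] using hy
    · simpa using hy
  · rw [Set.indicator_of_mem, Set.indicator_of_mem]
    · rfl
    · simpa [dist_eq_norm, norm_sub_rev] using hy
    · simpa using hy

theorem g_le (s : ℝ) (hs : 0 < s) (x : E3) (D : Set E3) :
    (∫ y in D, ff s (x - y)) ≤ ∫ z, |ff s z| := by
  have hi : Integrable (fun y => ff s (x - y)) := (ff_int s hs).1.comp_sub_left x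
  have h1 : (∫ y in D, ff s (x - y)) ≤ ∫ y in D, |ff s (x - y)| :=
    integral_mono hi.integrableOn hi.abs.integrableOn fun y => le_abs_self _
  have h2 : ∫ y in D, |ff s (x - y)| ≤ ∫ y, |ff s (x - y)| :=
    setIntegral_le_integral hi.abs (Filter.Eventually.of_forall fun _ => abs_nonneg _)
  refine h1.trans (h2.trans (le_of_eq ?_))
  exact integral_sub_left_eq_self (fun z => |ff s z|) volume x

theorem CC (s : ℝ) (hs : 0 < s) (c : E3) (ρ T : ℝ) (hT : 0 ≤ T) :
    BB s (volume.restrict (Metric.closedBall c (ρ + T))) (volume.restrict (Metric.closedBall c (ρ + T))) ≤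
      ((∫ z, ff s z) + ep s T) * volume.real (Metric.closedBall c ρ) +
      (∫ z, |ff s z|) * (volume.real (Metric.closedBall c (ρ + T)) - volume.real (Metric.closedBall c ρ)) := by
  have : IsFiniteMeasure (volume.restrict (Metric.closedBall c (ρ + T))) :=
    ⟨by rw [Measure.restrict_apply_univ]; exact measure_closedBall_lt_top⟩
  have hb := BB_iter s (volume.restrict (Metric.closedBall c (ρ + T))) (volume.restrict (Metric.closedBall c (ρ + T)))
  rw [hb.1]
  have hsub : Metric.closedBall c ρ ⊆ Metric.closedBall c (ρ + T) := Metric.closedBall_subset_closedBall (by linarith)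
  have hm : MeasurableSet (Metric.closedBall c ρ) := Metric.isClosed_closedBall.measurableSet
  have hm2 : MeasurableSet (Metric.closedBall c (ρ + T)) := Metric.isClosed_closedBall.measurableSet
  have hI : IntegrableOn (fun x => ∫ y in Metric.closedBall c (ρ + T), ff s (x - y)) (Metric.closedBall c (ρ + T)) := hb.2
  rw [← Set.union_sdiff_cancel hsub] at hI
  have e := setIntegral_union (Set.disjoint_sdiff_right) (hm2.diff hm) (hI.left_of_union) (hI.right_of_union)
  rw [Set.union_sdiff_cancel hsub] at e hI
  rw [e]
  have ne : ∀ r, volume (Metric.closedBall c r) ≠ ⊤ := fun r => measure_closedBall_lt_top.ne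
  refine add_le_add ?_ ?_
  · have := setIntegral_mono_on (μ := volume) (s := Metric.closedBall c ρ)
      (f := fun x => ∫ y in Metric.closedBall c (ρ + T), ff s (x - y)) (g := fun _ => (∫ z, ff s z) + ep s T)
      (hI.mono_set hsub) (integrableOn_const (ne ρ)) hm (fun x hx => by
        have := g_near s hs x T (Metric.closedBall c (ρ + T)) hm2 (by
          refine Metric.closedBall_subset_closedBall' ?_
          have : dist x c ≤ ρ := hx
          linarith)
        have := (abs_le.1 this).2
        linarith)
    refine this.trans (le_of_eq ?_)
    rw [setIntegral_const, smul_eq_mul, mul_comm]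
  · have := setIntegral_mono_on (μ := volume) (s := Metric.closedBall c (ρ + T) \ Metric.closedBall c ρ)
      (f := fun x => ∫ y in Metric.closedBall c (ρ + T), ff s (x - y)) (g := fun _ => (∫ z, |ff s z|))
      (hI.mono_set Set.sdiff_subset) (integrableOn_const (ne_top_of_le_ne_top (ne (ρ+T)) (measure_mono Set.sdiff_subset))) (hm2.diff hm) (fun x hx => g_le s hs x _)
    refine this.trans (le_of_eq ?_)
    rw [setIntegral_const, smul_eq_mul, mul_comm, measureReal_sdiff hsub hm (ne _)]

theorem count_bound (s : ℝ) (hs : 0 < s) (c : E3) (ρ T θ : ℝ) (hT : 0 ≤ T) (hθ : 0 ≤ θ) (S : Finset E3)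
    (hS : ∀ x ∈ S, dist x c ≤ ρ) (hsep : ∀ x ∈ S, ∀ y ∈ S, x ≠ y → ff s (x - y) ≤ 0) :
    0 ≤ S.card * ff s 0 - 2 * θ * (S.card * ((∫ z, ff s z) - ep s T)) + θ ^ 2 * (
      ((∫ z, ff s z) + ep s T) * volume.real (Metric.closedBall c ρ) +
      (∫ z, |ff s z|) * (volume.real (Metric.closedBall c (ρ + T)) - volume.real (Metric.closedBall c ρ))) := by
  have : IsFiniteMeasure (volume.restrict (Metric.closedBall c (ρ + T))) :=
    ⟨by rw [Measure.restrict_apply_univ]; exact measure_closedBall_lt_top⟩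
  have h := BB_pos s θ (pts S) (volume.restrict (Metric.closedBall c (ρ + T)))
  have hC := CC s hs c ρ T hT
  have hA : BB s (pts S) (pts S) ≤ S.card * ff s 0 := by
    rw [(BB_iter s (pts S) (pts S)).1]
    simp only [integral_pts]
    rw [← nsmul_eq_mul]
    refine Finset.sum_le_card_nsmul _ _ _ fun x hx => ?_
    rw [Finset.sum_eq_add_sum_sdiff_singleton_of_mem hx, sub_self]
    have : ∑ y ∈ S \ {x}, ff s (x - y) ≤ 0 := Finset.sum_nonpos fun y hy => by
      simp only [Finset.mem_sdiff, Finset.mem_singleton] at hy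
      exact hsep x hx y hy.1 (fun h => hy.2 h.symm)
    linarith
  have hB : S.card * ((∫ z, ff s z) - ep s T) ≤ BB s (pts S) (volume.restrict (Metric.closedBall c (ρ + T))) := by
    rw [(BB_iter s (pts S) _).1, integral_pts, ← nsmul_eq_mul]
    refine Finset.card_nsmul_le_sum _ _ _ fun x hx => ?_
    have := g_near s hs x T (Metric.closedBall c (ρ + T)) Metric.isClosed_closedBall.measurableSet (by
          refine Metric.closedBall_subset_closedBall' ?_
          have := hS x hx
          linarith)
    have := (abs_le.1 this).1
    linarith
  have hC' := mul_le_mul_of_nonneg_left hC (sq_nonneg θ)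
  have hB' := mul_le_mul_of_nonneg_left hB (by linarith : 0 ≤ 2 * θ)
  linarith
end SB

namespace SB

def pr (c : ℕ) : ℕ → ℕ
  | 0 => 1
  | n + 1 => (5 * n + 5 + c) * pr c n

theorem pr_pos (c n : ℕ) : 0 < pr c n := by
  induction n with
  | zero => simp [pr]
  | succ n ih => simp only [pr]; positivity

theorem pr_gamma (c n : ℕ) : Real.Gamma (n + 1 + c / 5) * 5 ^ n = pr c n * Real.Gamma (1 + c / 5) := by
  induction n with
  | zero => simp [pr]
  | succ n ih =>
    have : (((n + 1 : ℕ) : ℝ) + 1 + c / 5) = (n + 1 + c / 5 : ℝ) + 1 := by push_cast; ring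
    rw [this, Real.Gamma_add_one (by positivity)]
    simp only [pr]
    push_cast
    rw [mul_assoc (5 * (n : ℝ) + 5 + c), ← ih]
    ring

theorem gam_up (n : ℕ) : Real.Gamma (n + 1 + 1 / 5) ≤ Real.Gamma (n + 1) * (n + 1 : ℝ) ^ (1 / 5 : ℝ) := by
  have h := Real.Gamma_mul_add_mul_le_rpow_Gamma_mul_rpow_Gamma (s := n + 1) (t := n + 1 + 1) (a := 4 / 5) (b := 1 / 5)
    (by positivity) (by positivity) (by norm_num) (by norm_num) (by norm_num)
  have e : (4 / 5 * (n + 1) + 1 / 5 * (n + 1 + 1) : ℝ) = n + 1 + 1 / 5 := by ring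
  have hp : 0 < Real.Gamma (n + 1 : ℝ) := Real.Gamma_pos_of_pos (by positivity)
  rw [e, Real.Gamma_add_one (s := (n : ℝ) + 1) (by positivity), Real.mul_rpow (by positivity) hp.le,
    mul_left_comm, ← Real.rpow_add hp] at h
  norm_num at h ⊢
  linarith

theorem gam_lo (n : ℕ) : (n + 1) * Real.Gamma (n + 1) ≤ Real.Gamma (n + 1 + 3 / 5) * (n + 1 + 3 / 5 : ℝ) ^ (2 / 5 : ℝ) := by
  have h := Real.Gamma_mul_add_mul_le_rpow_Gamma_mul_rpow_Gamma (s := n + 1 + 3 / 5) (t := n + 1 + 3 / 5 + 1) (a := 3 / 5) (b := 2 / 5)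
    (by positivity) (by positivity) (by norm_num) (by norm_num) (by norm_num)
  have e : (3 / 5 * (n + 1 + 3 / 5) + 2 / 5 * (n + 1 + 3 / 5 + 1) : ℝ) = n + 1 + 1 := by ring
  have hp : 0 < Real.Gamma (n + 1 + 3 / 5 : ℝ) := Real.Gamma_pos_of_pos (by positivity)
  rw [e, Real.Gamma_add_one (s := (n : ℝ) + 1) (by positivity), Real.Gamma_add_one (s := (n : ℝ) + 1 + 3 / 5) (by positivity), Real.mul_rpow (by positivity) hp.le,
    mul_left_comm, ← Real.rpow_add hp] at h
  norm_num at h ⊢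
  linarith

theorem vol_gam (n : ℕ) : Real.Gamma (1 + 1 / 5) ^ 3 * ((n + 1) * pr 1 n ^ 3) ≤
    Real.Gamma (1 + 3 / 5) * ((n + 1.24) * (pr 0 n ^ 2 * pr 3 n)) := by
  have h0 := pr_gamma 0 n
  have h1 := pr_gamma 1 n
  have h3 := pr_gamma 3 n
  have hu := gam_up n
  have hl := gam_lo n
  have hag := Real.geom_mean_le_arith_mean2_weighted (w₁ := 3 / 5) (w₂ := 2 / 5) (p₁ := n + 1) (p₂ := n + 1 + 3 / 5)
    (by norm_num) (by norm_num) (by positivity) (by positivity) (by norm_num)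
  push_cast at h0 h1 h3
  simp only [zero_div, add_zero, Real.Gamma_one, mul_one] at h0
  have e : ((n + 1 : ℝ) ^ (1 / 5 : ℝ)) ^ 3 = (n + 1 : ℝ) ^ (3 / 5 : ℝ) := by
    rw [← Real.rpow_natCast, ← Real.rpow_mul (by positivity)]; norm_num
  set G := Real.Gamma (n + 1 : ℝ)
  have hG : 0 < G := Real.Gamma_pos_of_pos (by positivity)
  set G1 := Real.Gamma (n + 1 + 1 / 5 : ℝ)
  have hG1 : 0 < G1 := Real.Gamma_pos_of_pos (by positivity)
  set G3 := Real.Gamma (n + 1 + 3 / 5 : ℝ)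
  have hG3 : 0 < G3 := Real.Gamma_pos_of_pos (by positivity)
  set u := (n + 1 : ℝ) ^ (1 / 5 : ℝ)
  set w := (n + 1 + 3 / 5 : ℝ) ^ (2 / 5 : ℝ)
  have hu0 : 0 < u := by positivity
  have hw0 : 0 < w := by positivity
  have i1 : G1 ^ 3 ≤ (G * u) ^ 3 := by gcongr
  rw [← e] at hag
  have key : G1 ^ 3 * (n + 1) ≤ G3 * G ^ 2 * (n + 1.24) := by
    calc G1 ^ 3 * (n + 1) ≤ (G * u) ^ 3 * (n + 1) := by gcongr
      _ = G ^ 2 * u ^ 3 * ((n + 1) * G) := by ring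
      _ ≤ G ^ 2 * u ^ 3 * (G3 * w) := by gcongr
      _ = G3 * G ^ 2 * (u ^ 3 * w) := by ring
      _ ≤ G3 * G ^ 2 * (n + 1.24) := by
        gcongr
        refine hag.trans (le_of_eq ?_)
        ring
  have l : Real.Gamma (1 + 1 / 5) ^ 3 * ((n + 1) * pr 1 n ^ 3) = G1 ^ 3 * (n + 1) * (5 ^ n) ^ 3 := by
    have : (pr 1 n * Real.Gamma (1 + 1 / 5)) ^ 3 = (G1 * 5 ^ n) ^ 3 := by rw [h1]
    linear_combination (n + 1 : ℝ) * this
  have r : Real.Gamma (1 + 3 / 5) * ((n + 1.24) * (pr 0 n ^ 2 * pr 3 n)) = G3 * G ^ 2 * (n + 1.24) * (5 ^ n) ^ 3 := by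
    rw [← h0]
    linear_combination (n + 1.24 : ℝ) * (G * 5 ^ n) ^ 2 * (-h3)
  rw [l, r]
  gcongr

set_option maxRecDepth 100000 in
theorem pr_num : 8 * 60124 * (pr 0 600 ^ 2 * pr 3 600) * 1000 < 6935 * 60100 * pr 1 600 ^ 3 := by decide +kernel

theorem vol_num : (2 * Real.Gamma (1 / 5 + 1)) ^ 3 / Real.Gamma (3 / 5 + 1) < 6.935 := by
  have h := vol_gam 600
  have hn : (8 * 60124 * (pr 0 600 ^ 2 * pr 3 600) * 1000 : ℝ) < 6935 * 60100 * pr 1 600 ^ 3 := by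
    exact_mod_cast pr_num
  rw [add_comm (1 / 5 : ℝ), add_comm (3 / 5 : ℝ)]
  have hG : 0 < Real.Gamma (1 + 3 / 5 : ℝ) := Real.Gamma_pos_of_pos (by positivity)
  have hp : (0 : ℝ) < pr 1 600 := by exact_mod_cast pr_pos 1 600
  generalize (pr 0 600 : ℝ) = a at *
  generalize (pr 1 600 : ℝ) = b at *
  generalize (pr 3 600 : ℝ) = d at *
  rw [div_lt_iff₀ hG]
  have h2 := mul_lt_mul_of_pos_left hn hG
  have hb : 0 < b ^ 3 := by positivity
  refine lt_of_mul_lt_mul_right (a := 601 * b ^ 3) ?_ (by positivity)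
  push_cast at h
  nlinarith

noncomputable def Bs : Set E3 := {x | |x 0| ^ 5 + |x 1| ^ 5 + |x 2| ^ 5 ≤ 1}

theorem vol_B : volume.real Bs < 6.935 ∧ volume Bs ≠ ⊤ := by
  have h := EuclideanSpace.volume_preserving_symm_measurableEquiv_toLp (Fin 3)
  have e : Bs = (MeasurableEquiv.toLp 2 (Fin 3 → ℝ)).symm ⁻¹' {x : Fin 3 → ℝ | (∑ i, |x i| ^ (5 : ℝ)) ^ (1 / (5 : ℝ)) ≤ 1} := by
    ext x
    have e5 : ∀ t : ℝ, t ^ (5 : ℝ) = t ^ 5 := fun t => by exact_mod_cast Real.rpow_natCast t 5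
    simp only [Bs, Set.mem_ofPred_eq, Set.mem_preimage, Fin.sum_univ_three, e5]
    have h0 : 0 ≤ |x 0| ^ 5 + |x 1| ^ 5 + |x 2| ^ 5 := by positivity
    rw [show ((MeasurableEquiv.toLp 2 (Fin 3 → ℝ)).symm x) = x.ofLp from rfl]
    rw [← Real.rpow_le_rpow_iff (z := 5⁻¹) h0 zero_le_one (by norm_num), Real.one_rpow, one_div]
  have hv : volume Bs = ENNReal.ofReal ((2 * Real.Gamma (1 / 5 + 1)) ^ 3 / Real.Gamma (3 / 5 + 1)) := by
    rw [e, h.measure_preimage_emb (MeasurableEquiv.measurableEmbedding _), volume_sum_rpow_le (ι := Fin 3) (p := 5) (by norm_num) 1]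
    simp
  constructor
  · rw [Measure.real, hv, ENNReal.toReal_ofReal]
    · exact vol_num
    · have := Real.Gamma_pos_of_pos (s := 1 / 5 + 1) (by norm_num)
      have := Real.Gamma_pos_of_pos (s := 3 / 5 + 1) (by norm_num)
      positivity
  · rw [hv]; exact ENNReal.ofReal_ne_top

theorem q_num : ff (5/4) 0 / (∫ z, ff (5/4) z) * 6.935 < 0.9225 := by
  have e : ff (5/4) 0 = Ph 0 := by unfold ff; congr 1; funext i; simp
  rw [e, Ph_zero, (ff_int _ (by norm_num)).2]
  have hs : √(2 * Real.pi) ^ 2 = 2 * Real.pi := Real.sq_sqrt (by positivity)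
  have h2 : (2.5066 : ℝ) < √(2 * Real.pi) := by
    apply Real.lt_sqrt_of_sq_lt
    have := Real.pi_gt_d6
    norm_num; linarith
  generalize √(2 * Real.pi) = t at *
  rw [← hs]
  have ht : 0 < t := by linarith
  have h3 : (2.5066 : ℝ) ^ 3 < t ^ 3 := by gcongr
  have : t ^ 3 * 1072209372649 / ((t ^ 2 / (5/4)) ^ 3 * 1000000000000) * 6.935 = (1072209372649 * 125/ 64 / 1000000000000 * 6.935) / t ^ 3 := by
    field_simp
    norm_num
  rw [this, div_lt_iff₀ (by positivity)]
  norm_num at h3 ⊢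
  linarith
end SB

namespace SB

theorem poly_asym (a b d T : ℝ) (hab : a < b) :
    ∃ r0 > 0, ∀ r ≥ r0, a * (r + 2) ^ 3 + d * ((r + 2 + T) ^ 3 - (r + 2) ^ 3) ≤ b * r ^ 3 := by
  have hz : Filter.Tendsto (fun r : ℝ => r⁻¹) Filter.atTop (nhds 0) := tendsto_inv_atTop_zero
  have hc : Continuous (fun x : ℝ => a * (1 + 2 * x) ^ 3 + d * ((1 + (2 + T) * x) ^ 3 - (1 + 2 * x) ^ 3)) := by fun_prop
  have h := (hc.tendsto 0).comp hz
  have h2 := h.eventually_lt_const (u := b) (by simpa using hab)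
  obtain ⟨r0, hr⟩ := Filter.eventually_atTop.1 h2
  refine ⟨max r0 1, by positivity, fun r hr' => ?_⟩
  have h1 : 0 < r := lt_of_lt_of_le one_pos ((le_max_right _ _).trans hr')
  have h3 := (hr r ((le_max_left _ _).trans hr')).le
  simp only [Function.comp] at h3
  have h4 := mul_le_mul_of_nonneg_right h3 (by positivity : 0 ≤ r ^ 3)
  refine le_trans (le_of_eq ?_) h4
  field_simp
  ring

theorem volr (c : E3) (r : ℝ) (hr : 0 ≤ r) :
    volume.real (Metric.closedBall c r) = r ^ 3 * volume.real (Metric.closedBall (0 : E3) 1) := by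
  have := Measure.addHaar_real_closedBall' (volume : Measure E3) c hr
  simpa using this

theorem count_asym (s : ℝ) (hs : 0 < s) (κ : ℝ) (hI : 0 < ∫ z, ff s z) (h0 : 0 < ff s 0)
    (hκ : ff s 0 / (∫ z, ff s z) < κ) :
    ∃ r0 > 0, ∀ r ≥ r0, ∀ (c : E3) (S : Finset E3), (∀ x ∈ S, dist x c ≤ r + 2) →
      (∀ x ∈ S, ∀ y ∈ S, x ≠ y → ff s (x - y) ≤ 0) → (S.card : ℝ) ≤ κ * volume.real (Metric.closedBall c r) := by
  have hcb' := fun c ρ T q hT hq S => count_bound s hs c ρ T q hT hq S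
  generalize ff s 0 = F at *
  generalize (∫ z, ff s z) = I at *
  obtain ⟨q, hq⟩ : ∃ q, q = F / I := ⟨_, rfl⟩
  rw [← hq] at hκ
  have hq0 : 0 < q := by rw [hq]; exact div_pos h0 hI
  have hqI : q * I = F := by rw [hq]; exact div_mul_cancel₀ _ hI.ne'
  have t1 : Filter.Tendsto (fun T => q ^ 2 * (I + ep s T) - κ * (F - 2 * q * ep s T)) Filter.atTop
      (nhds (q ^ 2 * (I + 0) - κ * (F - 2 * q * 0))) :=
    (((ep_tendsto s hs).const_add I).const_mul _).sub ((((ep_tendsto s hs).const_mul _).const_sub _).const_mul _)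
  have t2 : Filter.Tendsto (fun T => F - 2 * q * ep s T) Filter.atTop
      (nhds (F - 2 * q * 0)) := ((ep_tendsto s hs).const_mul _).const_sub _
  have e1 := t1.eventually_lt_const (u := 0) (by
    have : q ^ 2 * I = q * F := by rw [← hqI]; ring
    nlinarith)
  have e2 := t2.eventually_const_lt (u := 0) (by linarith)
  obtain ⟨T, hT1, hT2, hT⟩ := (e1.and (e2.and (Filter.eventually_ge_atTop 0))).exists
  obtain ⟨r0, hr0, hr⟩ := poly_asym (q ^ 2 * (I + ep s T)) (κ * (F - 2 * q * ep s T))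
    (q ^ 2 * ∫ z, |ff s z|) T (by linarith)
  refine ⟨r0, hr0, fun r hrr c S hS hsep => ?_⟩
  have hcb := hcb' c (r + 2) T q hT hq0.le S hS hsep
  have hp := hr r hrr
  have hrp : 0 < r := by linarith
  rw [volr c _ (by linarith), volr c _ (by linarith)] at hcb
  rw [volr c _ (by linarith)]
  have hv : 0 ≤ volume.real (Metric.closedBall (0 : E3) 1) := measureReal_nonneg
  generalize volume.real (Metric.closedBall (0 : E3) 1) = V at *
  have hp' := mul_le_mul_of_nonneg_right hp hv
  refine le_of_mul_le_mul_right (a := F - 2 * q * ep s T) ?_ hT2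
  have : 2 * q * ((S.card : ℝ) * (I - ep s T)) = 2 * S.card * F - 2 * q * S.card * ep s T := by
    rw [← hqI]; ring
  rw [this] at hcb
  linarith

theorem ff_sep (z : E3) (h : 32 ≤ |z 0| ^ 5 + |z 1| ^ 5 + |z 2| ^ 5) : ff (5/4) z ≤ 0 := by
  unfold ff
  apply Ph_nonpos
  simp only [abs_mul, mul_pow]
  rw [abs_of_pos (by norm_num : (0:ℝ) < 5/4)]
  linarith

theorem Bs_int : {x : E3 | |x 0| ^ 5 + |x 1| ^ 5 + |x 2| ^ 5 < 1} ⊆ interior Bs := by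
  refine interior_maximal (fun x hx => ?_) ?_
  · exact le_of_lt (show |x 0| ^ 5 + |x 1| ^ 5 + |x 2| ^ 5 < 1 from hx)
  exact isOpen_lt (by fun_prop) continuous_const

theorem Bs_norm (x : E3) (hx : x ∈ Bs) : ‖x‖ ≤ 2 := by
  have hx : |x 0| ^ 5 + |x 1| ^ 5 + |x 2| ^ 5 ≤ 1 := hx
  have h : ∀ t : ℝ, |t| ^ 5 ≤ 1 → t ^ 2 ≤ 1 := by
    intro t ht
    have := (pow_le_one_iff_of_nonneg (abs_nonneg t) (by norm_num)).1 ht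
    rw [← sq_abs]; exact pow_le_one₀ (abs_nonneg _) this
  have p0 : 0 ≤ |x 0| ^ 5 := by positivity
  have p1 : 0 ≤ |x 1| ^ 5 := by positivity
  have p2 : 0 ≤ |x 2| ^ 5 := by positivity
  have h0 := h (x 0) (by linarith)
  have h1 := h (x 1) (by linarith)
  have h2 := h (x 2) (by linarith)
  rw [EuclideanSpace.norm_eq, Real.sqrt_le_iff, Fin.sum_univ_three]
  simp only [Real.norm_eq_abs, sq_abs]
  constructor <;> linarith

theorem pack_sep (X : Set E3) (hX : IsTranslativePacking Bs X) (x y : E3) (hx : x ∈ X) (hy : y ∈ X) (hne : x ≠ y) :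
    32 ≤ |(x - y) 0| ^ 5 + |(x - y) 1| ^ 5 + |(x - y) 2| ^ 5 := by
  by_contra hlt
  push Not at hlt
  have hd := hX x hx y hy hne
  rw [Set.disjoint_left] at hd
  have m : ∀ σ : ℝ, |σ| = 1/2 → σ • (x - y) ∈ interior Bs := by
    intro σ hσ
    apply Bs_int
    show |(σ • (x - y)) 0| ^ 5 + |(σ • (x - y)) 1| ^ 5 + |(σ • (x - y)) 2| ^ 5 < 1
    simp only [PiLp.smul_apply, smul_eq_mul, abs_mul, hσ, mul_pow]
    linarith
  refine hd (a := (1/2 : ℝ) • (x + y)) ⟨(-(1/2) : ℝ) • (x - y), m _ (by norm_num), ?_⟩ ⟨(1/2 : ℝ) • (x - y), m _ (by norm_num), ?_⟩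
  · simp only; module
  · simp only; module

theorem dens (X : Set E3) (hX : IsTranslativePacking Bs X) :
    ∃ r0 > 0, ∀ r ≥ r0, ∀ c : E3,
      (volume (Metric.closedBall c r ∩ ⋃ x ∈ X, (fun z => x + z) '' Bs) / volume (Metric.closedBall c r)).toReal ≤ 0.9225 := by
  have hI : 0 < ∫ z, ff (5/4) z := by rw [(ff_int _ (by norm_num)).2]; positivity
  have h0 : 0 < ff (5/4) 0 := by
    have e : ff (5/4) 0 = Ph 0 := by unfold ff; congr 1; funext i; simp
    rw [e, Ph_zero]; positivity
  have hq := q_num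
  obtain ⟨r0, hr0, hr⟩ := count_asym (5/4) (by norm_num) (0.9225 / 6.935) hI h0 (by
    rw [lt_div_iff₀ (by norm_num)]; exact hq)
  refine ⟨r0, hr0, fun r hrr c => ?_⟩
  set Y := {x ∈ X | dist x c ≤ r + 2} with hY
  have cnt : ∀ S : Finset E3, (S : Set E3) ⊆ Y → (S.card : ℝ) ≤ 0.9225 / 6.935 * volume.real (Metric.closedBall c r) := by
    intro S hS
    refine hr r hrr c S (fun x hx => (hS hx).2) fun x hx y hy hne => ?_
    exact ff_sep _ (pack_sep X hX x y (hS hx).1 (hS hy).1 hne)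
  have hfin : Y.Finite := by
    by_contra hinf
    obtain ⟨n, hn⟩ := exists_nat_gt (0.9225 / 6.935 * volume.real (Metric.closedBall c r))
    obtain ⟨S, hS, hc⟩ := Set.Infinite.exists_subset_card_eq hinf n
    have := cnt S hS
    rw [hc] at this
    linarith
  have hsub : Metric.closedBall c r ∩ (⋃ x ∈ X, (fun z => x + z) '' Bs) ⊆ ⋃ x ∈ hfin.toFinset, (fun z => x + z) '' Bs := by
    rintro w ⟨hw, hw2⟩
    simp only [Set.mem_iUnion] at hw2 ⊢
    obtain ⟨x, hx, z, hz, rfl⟩ := hw2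
    refine ⟨x, ?_, z, hz, rfl⟩
    rw [Set.Finite.mem_toFinset]
    refine ⟨hx, ?_⟩
    have h1 : dist (x + z) c ≤ r := hw
    have h2 : dist x (x + z) ≤ 2 := by simpa [dist_eq_norm] using Bs_norm z hz
    linarith [dist_triangle x (x + z) c]
  have hm : volume (Metric.closedBall c r ∩ (⋃ x ∈ X, (fun z => x + z) '' Bs)) ≤ hfin.toFinset.card * volume Bs := by
    refine (measure_mono hsub).trans ((measure_biUnion_finset_le _ _).trans (le_of_eq ?_))
    simp only [Set.image_add_left, measure_preimage_add, Finset.sum_const, nsmul_eq_mul]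
  have hm2 : volume.real (Metric.closedBall c r ∩ (⋃ x ∈ X, (fun z => x + z) '' Bs)) ≤ hfin.toFinset.card * volume.real Bs := by
    have := ENNReal.toReal_mono (ENNReal.mul_ne_top (ENNReal.natCast_ne_top _) vol_B.2) hm
    simpa [Measure.real] using this
  have hc := cnt hfin.toFinset (by simp)
  rw [ENNReal.toReal_div]
  refine div_le_of_le_mul₀ ENNReal.toReal_nonneg (by norm_num) ?_
  refine hm2.trans ?_
  have hv := vol_B.1.le
  have : (hfin.toFinset.card : ℝ) * volume.real Bs ≤ hfin.toFinset.card * 6.935 := by gcongr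
  refine this.trans ?_
  have := mul_le_mul_of_nonneg_right hc (by norm_num : (0:ℝ) ≤ 6.935)
  refine this.trans (le_of_eq ?_)
  rw [Measure.real]
  ring

end SB

/-- Every translative packing of the superball `B⁵₃` has upper density at most `0.9225`. -/
theorem superball5_translative_packing_bound
    (B : Set (EuclideanSpace ℝ (Fin 3)))
    (hB : B = {x : EuclideanSpace ℝ (Fin 3) | |x 0| ^ 5 + |x 1| ^ 5 + |x 2| ^ 5 ≤ 1})
    (X : Set (EuclideanSpace ℝ (Fin 3)))
    (hX : IsTranslativePacking B X) :
    packingUpperDensity B X ≤ 0.9225 := by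
  have e : B = SB.Bs := hB
  rw [e] at hX ⊢
  obtain ⟨r0, hr0, hr⟩ := SB.dens X hX
  unfold packingUpperDensity
  refine Filter.limsup_le_of_le ?_ ?_
  · refine Filter.isCoboundedUnder_le_of_le (x := 0) Filter.atTop fun r => ?_
    exact Real.iSup_nonneg fun c => ENNReal.toReal_nonneg
  · filter_upwards [Filter.eventually_ge_atTop r0] with r h
    exact ciSup_le fun c => hr r h c
end

section
/- Let TC ⊆ ℝ³ be the truncated cube given as the convex hull of the 24 points obtained as all coordinate permutations of (±(√2 − 1), ±1, ±1). Then every translative packing of TC has upper density at most 0.9846. -/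
open MeasureTheory Filter Metric

/-- Euclidean three-space. -/
abbrev E3 : Type := EuclideanSpace ℝ (Fin 3)

/-- sign of a boolean -/
def sg (b : Bool) : ℝ := if b then 1 else -1

/-- `y` overlaps `x` at the corner with signs `σ s t`. -/
def Mt (x y : E3) (σ s t : Bool) : Prop :=
  (0 < sg σ * (y 0 - x 0) ∧ sg σ * (y 0 - x 0) < 2) ∧
  (0 < sg s * (y 1 - x 1) ∧ sg s * (y 1 - x 1) < 2) ∧
  (0 < sg t * (y 2 - x 2) ∧ sg t * (y 2 - x 2) < 2)

/-- separation condition -/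
def Sepd (F : Finset E3) : Prop :=
  ∀ x ∈ F, ∀ y ∈ F, x ≠ y → |y 0 - x 0| < 2 → |y 1 - x 1| < 2 → |y 2 - x 2| < 2 →
    (4.8284 : ℝ) ≤ |y 0 - x 0| + |y 1 - x 1| + |y 2 - x 2|

/-- open box -/
def bx (l h : Fin 3 → ℝ) : Set E3 := {p | ∀ i, l i < p i ∧ p i < h i}

lemma bx_eq (l h : Fin 3 → ℝ) :
    bx l h = (fun p : E3 => p.ofLp) ⁻¹' (Set.univ.pi fun i => Set.Ioo (l i) (h i)) := by
  ext p
  simp [bx]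

lemma bx_meas (l h : Fin 3 → ℝ) : MeasurableSet (bx l h) := by
  rw [bx_eq]
  exact (PiLp.volume_preserving_ofLp (Fin 3)).measurable
    (MeasurableSet.univ_pi fun i => measurableSet_Ioo)

lemma bx_vol (l h : Fin 3 → ℝ) : volume (bx l h) = ∏ i, ENNReal.ofReal (h i - l i) := by
  rw [bx_eq, (PiLp.volume_preserving_ofLp (Fin 3)).measure_preimage
    (MeasurableSet.univ_pi fun i => measurableSet_Ioo).nullMeasurableSet, volume_pi_pi]
  simp

lemma bx_real (l h : Fin 3 → ℝ) (hl : ∀ i, l i ≤ h i) :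
    volume.real (bx l h) = (h 0 - l 0) * (h 1 - l 1) * (h 2 - l 2) := by
  rw [Measure.real, bx_vol, ENNReal.toReal_prod, Fin.prod_univ_three,
    ENNReal.toReal_ofReal (by linarith [hl 0]), ENNReal.toReal_ofReal (by linarith [hl 1]),
    ENNReal.toReal_ofReal (by linarith [hl 2])]

/-- the open cube of side two centred at `x` -/
def Qb (x : E3) : Set E3 := bx (fun i => x i - 1) (fun i => x i + 1)

/-- the hole between `y` and `z` -/
def hole (y z : E3) : Set E3 :=
  bx ![z 0 + 1, (y 1 + z 1) / 2 - 0.16, (y 2 + z 2) / 2 - 0.16]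
    ![y 0 - 1, (y 1 + z 1) / 2 + 0.16, (y 2 + z 2) / 2 + 0.16]

/-- condition for a genuine hole -/
def good (x y z : E3) (s t : Bool) : Prop :=
  Mt x y true s t ∧ Mt x z false s t ∧ y 0 - z 0 ≤ 3.83 ∧ |y 1 - z 1| + |y 2 - z 2| ≤ 1.18

/-- the hole attached to an edge -/
def Ho (F : Finset E3) (x : E3) (s t : Bool) : Set E3 :=
  ⋃ y ∈ F, ⋃ z ∈ F, ⋃ (_ : good x y z s t), hole y z

lemma Ho_meas (F : Finset E3) (x : E3) (s t : Bool) : MeasurableSet (Ho F x s t) := by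
  refine Finset.measurableSet_biUnion _ fun y _ => Finset.measurableSet_biUnion _ fun z _ =>
    MeasurableSet.iUnion fun _ => bx_meas _ _

lemma mem_Qb {x p : E3} : p ∈ Qb x ↔ |p 0 - x 0| < 1 ∧ |p 1 - x 1| < 1 ∧ |p 2 - x 2| < 1 := by
  simp only [Qb, bx, Set.mem_ofPred_eq, abs_lt, Fin.forall_fin_succ, Fin.succ_zero_eq_one,
    Fin.succ_one_eq_two, IsEmpty.forall_iff, and_true]
  constructor
  · rintro ⟨⟨a, b⟩, ⟨c, d⟩, ⟨e, f⟩⟩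
    refine ⟨⟨?_, ?_⟩, ⟨?_, ?_⟩, ⟨?_, ?_⟩⟩ <;> linarith
  · rintro ⟨⟨a, b⟩, ⟨c, d⟩, ⟨e, f⟩⟩
    refine ⟨⟨?_, ?_⟩, ⟨?_, ?_⟩, ⟨?_, ?_⟩⟩ <;> linarith

lemma mem_hole {y z p : E3} : p ∈ hole y z ↔ (z 0 + 1 < p 0 ∧ p 0 < y 0 - 1) ∧
    |p 1 - (y 1 + z 1) / 2| < 0.16 ∧ |p 2 - (y 2 + z 2) / 2| < 0.16 := by
  simp only [hole, bx, Set.mem_ofPred_eq, abs_lt, Fin.forall_fin_succ, Fin.succ_zero_eq_one,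
    Fin.succ_one_eq_two, IsEmpty.forall_iff, and_true]
  simp only [Matrix.cons_val]
  constructor
  · rintro ⟨⟨a, b⟩, ⟨c, d⟩, ⟨e, f⟩⟩
    refine ⟨⟨?_, ?_⟩, ⟨?_, ?_⟩, ⟨?_, ?_⟩⟩ <;> linarith
  · rintro ⟨⟨a, b⟩, ⟨c, d⟩, ⟨e, f⟩⟩
    refine ⟨⟨?_, ?_⟩, ⟨?_, ?_⟩, ⟨?_, ?_⟩⟩ <;> linarith

lemma sg_cases (b : Bool) : sg b = 1 ∨ sg b = -1 := by cases b <;> simp [sg]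

lemma sg_abs {b : Bool} {r : ℝ} (h : 0 < sg b * r) : |r| = sg b * r := by
  rcases sg_cases b with hb | hb <;> rw [hb] at h ⊢
  · rw [abs_of_pos] <;> linarith
  · rw [abs_of_neg] <;> linarith

/-- L1 consequence of separation, in signed form -/
lemma Mt_sum {F : Finset E3} (hF : Sepd F) {x y : E3} (hx : x ∈ F) (hy : y ∈ F) {σ s t : Bool}
    (h : Mt x y σ s t) :
    4.8284 ≤ sg σ * (y 0 - x 0) + sg s * (y 1 - x 1) + sg t * (y 2 - x 2) := by
  obtain ⟨⟨a, a'⟩, ⟨b, b'⟩, c, c'⟩ := h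
  have hne : x ≠ y := by rintro rfl; simp at a
  have := hF x hx y hy hne
  rw [sg_abs a, sg_abs b, sg_abs c] at this
  exact this a' b' c'

lemma sg_sub_abs (b : Bool) (r : ℝ) : |sg b * r| = |r| := by
  rcases sg_cases b with hb | hb <;> rw [hb] <;> simp

/-- at most one cube overlaps at a given corner -/
lemma Mt_unique {F : Finset E3} (hF : Sepd F) {x y y' : E3} (hx : x ∈ F) (hy : y ∈ F) (hy' : y' ∈ F)
    {σ s t : Bool} (h : Mt x y σ s t) (h' : Mt x y' σ s t) : y = y' := by
  by_contra hne
  have h1 := Mt_sum hF hx hy h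
  have h2 := Mt_sum hF hx hy' h'
  obtain ⟨⟨a, a'⟩, ⟨b, b'⟩, c, c'⟩ := h
  obtain ⟨⟨d, d'⟩, ⟨e, e'⟩, f, f'⟩ := h'
  have k := hF y hy y' hy' hne
  rw [← sg_sub_abs σ (y' 0 - y 0), ← sg_sub_abs s (y' 1 - y 1), ← sg_sub_abs t (y' 2 - y 2)] at k
  have e0 : sg σ * (y' 0 - y 0) = sg σ * (y' 0 - x 0) - sg σ * (y 0 - x 0) := by ring
  have e1 : sg s * (y' 1 - y 1) = sg s * (y' 1 - x 1) - sg s * (y 1 - x 1) := by ring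
  have e2 : sg t * (y' 2 - y 2) = sg t * (y' 2 - x 2) - sg t * (y 2 - x 2) := by ring
  rw [e0, e1, e2] at k
  generalize sg σ * (y' 0 - x 0) = d0 at *
  generalize sg σ * (y 0 - x 0) = a0 at *
  generalize sg s * (y' 1 - x 1) = d1 at *
  generalize sg s * (y 1 - x 1) = a1 at *
  generalize sg t * (y' 2 - x 2) = d2 at *
  generalize sg t * (y 2 - x 2) = a2 at *
  have q0 : |d0 - a0| < 1.18 := by rw [abs_lt]; constructor <;> linarith
  have q1 : |d1 - a1| < 1.18 := by rw [abs_lt]; constructor <;> linarith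
  have q2 : |d2 - a2| < 1.18 := by rw [abs_lt]; constructor <;> linarith
  have := k (by linarith) (by linarith) (by linarith)
  linarith

lemma Mt_symm {x y : E3} {σ s t : Bool} : Mt x y σ s t ↔ Mt y x (!σ) (!s) (!t) := by
  have : ∀ b : Bool, sg (!b) = - sg b := by intro b; cases b <;> simp [sg]
  simp only [Mt, this]
  constructor <;>
  · rintro ⟨⟨a, a'⟩, ⟨b, b'⟩, c, c'⟩
    refine ⟨⟨?_, ?_⟩, ⟨?_, ?_⟩, ?_, ?_⟩ <;> linarith

lemma aux1 {p w y z : ℝ} (h : |p - w| < 1) (h' : |p - (y + z) / 2| < 0.16) :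
    |y - w| ≤ 1.16 + |y - z| / 2 ∧ |z - w| ≤ 1.16 + |y - z| / 2 := by
  rw [abs_lt] at h h'
  rw [abs_le, abs_le]
  rcases abs_cases (y - z) with ⟨e, _⟩ | ⟨e, _⟩ <;> rw [e] <;>
    refine ⟨⟨?_, ?_⟩, ?_, ?_⟩ <;> linarith

lemma aux2 {p y z y' z' : ℝ} (h : |p - (y + z) / 2| < 0.16) (h' : |p - (y' + z') / 2| < 0.16) :
    |y' - y| ≤ 0.32 + |y - z| / 2 + |y' - z'| / 2 := by
  rw [abs_lt] at h h'
  rw [abs_le]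
  rcases abs_cases (y - z) with ⟨e, _⟩ | ⟨e, _⟩ <;> rw [e] <;>
  rcases abs_cases (y' - z') with ⟨e, _⟩ | ⟨e, _⟩ <;> rw [e] <;>
    refine ⟨?_, ?_⟩ <;> linarith

/-- a point in a hole is covered by no cube -/
lemma hole_empty {F : Finset E3} (hF : Sepd F) {x y z w p : E3} (hx : x ∈ F) (hy : y ∈ F) (hz : z ∈ F)
    (hw : w ∈ F) {s t : Bool} (hg : good x y z s t) (hp : p ∈ hole y z) : p ∉ Qb w := by
  rw [mem_hole] at hp
  rw [mem_Qb]
  rintro ⟨w0, w1, w2⟩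
  obtain ⟨hMy, hMz, hA, hD⟩ := hg
  obtain ⟨⟨p0, p0'⟩, p1, p2⟩ := hp
  have nwy : w ≠ y := by rintro rfl; rw [abs_lt] at w0; linarith
  have nwz : w ≠ z := by rintro rfl; rw [abs_lt] at w0; linarith
  have ky := hF w hw y hy nwy
  have kz := hF w hw z hz nwz
  have y1 := (aux1 w1 p1).1
  have y2 := (aux1 w2 p2).1
  have z1 := (aux1 w1 p1).2
  have z2 := (aux1 w2 p2).2
  have n1 := abs_nonneg (y 1 - z 1)
  have n2 := abs_nonneg (y 2 - z 2)
  rw [abs_lt] at w0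
  by_cases hc : y 0 - w 0 ≤ 1.915
  · have e : |y 0 - w 0| ≤ 1.915 := by rw [abs_le]; constructor <;> linarith
    have := ky (by linarith) (by linarith) (by linarith)
    linarith
  · have e : |z 0 - w 0| ≤ 1.915 := by rw [abs_le]; constructor <;> linarith
    have := kz (by linarith) (by linarith) (by linarith)
    linarith

/-- a point lies in at most one hole of each type -/
lemma hole_unique {F : Finset E3} (hF : Sepd F) {x y z x' y' z' p : E3} (hx : x ∈ F) (hy : y ∈ F)
    (hx' : x' ∈ F) (hy' : y' ∈ F)
    {s t : Bool} (hg : good x y z s t) (hp : p ∈ hole y z)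
    (hg' : good x' y' z' s t) (hp' : p ∈ hole y' z') : x = x' := by
  rw [mem_hole] at hp hp'
  obtain ⟨hMy, hMz, hA, hD⟩ := hg
  obtain ⟨⟨p0, p0'⟩, p1, p2⟩ := hp
  obtain ⟨hMy', hMz', hA', hD'⟩ := hg'
  obtain ⟨⟨r0, r0'⟩, r1, r2⟩ := hp'
  have hyy : y = y' := by
    by_contra hne
    have k := hF y hy y' hy' hne
    have y1 := aux2 p1 r1
    have y2 := aux2 p2 r2
    have n1 := abs_nonneg (y 1 - z 1)
    have n2 := abs_nonneg (y 2 - z 2)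
    have n1' := abs_nonneg (y' 1 - z' 1)
    have n2' := abs_nonneg (y' 2 - z' 2)
    have e : |y' 0 - y 0| ≤ 1.9 := by rw [abs_le]; constructor <;> linarith
    have := k (by linarith) (by linarith) (by linarith)
    linarith
  subst hyy
  rw [Mt_symm] at hMy hMy'
  exact Mt_unique hF hy hx hx' hMy hMy'

lemma prod_le {a b c : ℝ} (ha : 0 ≤ a) (hb : 0 ≤ b) (hc : 0 ≤ c) (h : a + b + c ≤ 1.1716) :
    a * b * c ≤ 0.06 := by
  have h1 : b * c ≤ ((1.1716 - a) / 2) ^ 2 := by nlinarith [sq_nonneg (b - c)]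
  have h2 : a * (b * c) ≤ a * ((1.1716 - a) / 2) ^ 2 := by gcongr
  have h3 : a * ((1.1716 - a) / 2) ^ 2 ≤ 0.06 := by
    nlinarith [mul_nonneg (show (0:ℝ) ≤ 2 * 0.9 - a by linarith) (sq_nonneg (a - 0.39))]
  linarith

lemma prod_le2 {a b c : ℝ} (ha : 0 ≤ a) (hb : 0 ≤ b) (hc : 0 ≤ c) (h : a + b + c ≤ 1.1716) :
    a * b * c ≤ 0.0735 / 2 + 0.0512 * (1 - a) := by
  have h1 : b * c ≤ ((1.1716 - a) / 2) ^ 2 := by nlinarith [sq_nonneg (b - c)]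
  have h2 : a * (b * c) ≤ a * ((1.1716 - a) / 2) ^ 2 := by gcongr
  have h3 : a * ((1.1716 - a) / 2) ^ 2 ≤ 0.0735 / 2 + 0.0512 * (1 - a) := by
    nlinarith [mul_nonneg (show (0:ℝ) ≤ 2 * 0.9 - a by linarith) (sq_nonneg (a - 0.48))]
  linarith

lemma prod_le3 {a b c : ℝ} (ha : 0 ≤ a) (hc : 0 ≤ c) (h : a + b + c ≤ 1.1716) :
    a * b * c ≤ 0.063 * (a + 2 * c) := by
  have h2 : a * c * b ≤ a * c * (1.1716 - a - c) := by
    have := mul_nonneg ha hc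
    gcongr; linarith
  nlinarith [mul_nonneg hc (sq_nonneg (a - 0.354)), mul_nonneg ha (sq_nonneg (c - 0.25)),
    mul_nonneg ha hc]

/-- The key numerical inequality. -/
lemma key_ineq {a b c a' b' c' V : ℝ} (ha : 0 ≤ a) (hb : 0 ≤ b) (hc : 0 ≤ c)
    (h : a + b + c ≤ 1.1716) (ha' : 0 ≤ a') (hb' : 0 ≤ b') (hc' : 0 ≤ c')
    (h' : a' + b' + c' ≤ 1.1716) (hV0 : 0 ≤ V)
    (hV : 0.17 ≤ a + a' → |b - b'| + |c - c'| ≤ 1.18 → 0.1024 * (2 - a - a') ≤ V) :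
    a * b * c + a' * b' * c' ≤ 0.0735 * 2 / 2 + V / 2 := by
  by_cases hA : 0.17 ≤ a + a'
  swap
  · have h1 : b * c ≤ 0.35 := by nlinarith [sq_nonneg (b - c)]
    have h2 : b' * c' ≤ 0.35 := by nlinarith [sq_nonneg (b' - c')]
    have h3 := mul_le_mul_of_nonneg_left h1 ha
    have h4 := mul_le_mul_of_nonneg_left h2 ha'
    linarith
  by_cases hD : |b - b'| + |c - c'| ≤ 1.18
  · have := hV hA hD
    have h1 := prod_le2 ha hb hc h
    have h2 := prod_le2 ha' hb' hc' h'
    linarith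
  · push Not at hD
    rcases abs_cases (b - b') with ⟨e1, _⟩ | ⟨e1, _⟩ <;>
      rcases abs_cases (c - c') with ⟨e2, _⟩ | ⟨e2, _⟩ <;> rw [e1, e2] at hD
    · linarith
    · have h1 := prod_le3 ha hc h
      have h2 := prod_le3 (b := c') (c := b') ha' hb' (by linarith)
      linarith
    · have h1 := prod_le3 (b := c) (c := b) ha hb (by linarith)
      have h2 := prod_le3 ha' hc' h'
      linarith
    · linarith

lemma Qcap_eq (x y : E3) :
    Qb x ∩ Qb y = bx (fun i => max (x i - 1) (y i - 1)) (fun i => min (x i + 1) (y i + 1)) := by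
  ext p
  simp only [Qb, bx, Set.mem_inter_iff, Set.mem_ofPred_eq, max_lt_iff, lt_min_iff]
  constructor
  · rintro ⟨h, h'⟩ i
    exact ⟨⟨(h i).1, (h' i).1⟩, (h i).2, (h' i).2⟩
  · intro h
    exact ⟨fun i => ⟨(h i).1.1, (h i).2.1⟩, fun i => ⟨(h i).1.2, (h i).2.2⟩⟩

lemma side_eq (a b : ℝ) : min (a + 1) (b + 1) - max (a - 1) (b - 1) = 2 - |b - a| := by
  rcases le_total a b with h | h
  · rw [min_eq_left (by linarith), max_eq_right (by linarith), abs_of_nonneg (by linarith)]; ring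
  · rw [min_eq_right (by linarith), max_eq_left (by linarith), abs_of_nonpos (by linarith)]; ring

lemma Qcap_real (x y : E3) (h : ∀ i, |y i - x i| ≤ 2) :
    volume.real (Qb x ∩ Qb y) = (2 - |y 0 - x 0|) * (2 - |y 1 - x 1|) * (2 - |y 2 - x 2|) := by
  rw [Qcap_eq, bx_real]
  · simp only [side_eq]
  · intro i
    have := side_eq (x i) (y i)
    have := h i
    linarith

lemma Mt_vol {x y : E3} {σ s t : Bool} (h : Mt x y σ s t) :
    volume.real (Qb x ∩ Qb y) = (2 - sg σ * (y 0 - x 0)) * (2 - sg s * (y 1 - x 1)) *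
      (2 - sg t * (y 2 - x 2)) := by
  obtain ⟨⟨a, a'⟩, ⟨b, b'⟩, c, c'⟩ := h
  rw [Qcap_real, sg_abs a, sg_abs b, sg_abs c]
  intro i
  fin_cases i
  · simp only [Fin.zero_eta, sg_abs a]; linarith
  · simp only [Fin.mk_one, sg_abs b]; linarith
  · simp only [Fin.reduceFinMk, sg_abs c]; linarith

lemma exists_sg {r : ℝ} (h : r ≠ 0) : ∃ b, 0 < sg b * r := by
  rcases lt_or_gt_of_ne h with h | h
  · exact ⟨false, by simp [sg, h]⟩
  · exact ⟨true, by simp [sg, h]⟩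

lemma exists_Mt {F : Finset E3} (hF : Sepd F) {x y : E3} (hx : x ∈ F) (hy : y ∈ F) (hne : x ≠ y)
    (h : (Qb x ∩ Qb y).Nonempty) : ∃ σ s t, Mt x y σ s t := by
  obtain ⟨p, hp, hp'⟩ := h
  rw [mem_Qb] at hp hp'
  have a0 : |y 0 - x 0| < 2 := by
    have h1 := abs_lt.1 hp.1; have h2 := abs_lt.1 hp'.1
    rw [abs_lt]; constructor <;> linarith
  have a1 : |y 1 - x 1| < 2 := by
    have h1 := abs_lt.1 hp.2.1; have h2 := abs_lt.1 hp'.2.1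
    rw [abs_lt]; constructor <;> linarith
  have a2 : |y 2 - x 2| < 2 := by
    have h1 := abs_lt.1 hp.2.2; have h2 := abs_lt.1 hp'.2.2
    rw [abs_lt]; constructor <;> linarith
  have k := hF x hx y hy hne a0 a1 a2
  have n0 : y 0 - x 0 ≠ 0 := by rw [← abs_pos]; linarith
  have n1 : y 1 - x 1 ≠ 0 := by rw [← abs_pos]; linarith
  have n2 : y 2 - x 2 ≠ 0 := by rw [← abs_pos]; linarith
  obtain ⟨σ, b0⟩ := exists_sg n0
  obtain ⟨s, b1⟩ := exists_sg n1
  obtain ⟨t, b2⟩ := exists_sg n2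
  rw [sg_abs b0] at a0
  rw [sg_abs b1] at a1
  rw [sg_abs b2] at a2
  exact ⟨σ, s, t, ⟨b0, a0⟩, ⟨b1, a1⟩, b2, a2⟩

open Classical in
/-- overlap volume at a corner -/
noncomputable def lo (F : Finset E3) (x : E3) (σ s t : Bool) : ℝ :=
  ∑ y ∈ F with Mt x y σ s t, volume.real (Qb x ∩ Qb y)

lemma lo_cases {F : Finset E3} (hF : Sepd F) {x : E3} (hx : x ∈ F) (σ s t : Bool) :
    lo F x σ s t = 0 ∨ ∃ y ∈ F, Mt x y σ s t ∧ lo F x σ s t = volume.real (Qb x ∩ Qb y) := by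
  classical
  by_cases h : ∃ y ∈ F, Mt x y σ s t
  · obtain ⟨y, hy, hM⟩ := h
    refine Or.inr ⟨y, hy, hM, ?_⟩
    rw [lo]
    have : F.filter (fun y => Mt x y σ s t) = {y} := by
      ext y'
      simp only [Finset.mem_filter, Finset.mem_singleton]
      constructor
      · rintro ⟨h1, h2⟩
        exact Mt_unique hF hx h1 hy h2 hM
      · rintro rfl
        exact ⟨hy, hM⟩
    rw [Finset.sum_congr (by convert this) (fun _ _ => rfl), Finset.sum_singleton]
  · left
    push Not at h
    rw [lo]
    apply Finset.sum_eq_zero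
    intro y hy
    rw [Finset.mem_filter] at hy
    exact absurd hy.2 (h y hy.1)

lemma Ho_finite (F : Finset E3) (x : E3) (s t : Bool) : volume (Ho F x s t) ≠ ⊤ := by
  rw [Ho]
  refine ((measure_biUnion_finset_le _ _).trans_lt ?_).ne
  refine ENNReal.sum_lt_top.2 fun y _ => (measure_biUnion_finset_le _ _).trans_lt ?_
  refine ENNReal.sum_lt_top.2 fun z _ => ?_
  refine (measure_mono (Set.iUnion_subset fun _ => Set.Subset.rfl)).trans_lt ?_
  rw [hole, bx_vol]
  exact ENNReal.prod_lt_top fun i _ => ENNReal.ofReal_lt_top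

lemma edge {F : Finset E3} (hF : Sepd F) {x : E3} (hx : x ∈ F) (s t : Bool) :
    lo F x true s t + lo F x false s t ≤ 0.0735 + volume.real (Ho F x s t) / 2 := by
  have hV0 : 0 ≤ volume.real (Ho F x s t) := measureReal_nonneg
  have one : ∀ σ y, y ∈ F → Mt x y σ s t → volume.real (Qb x ∩ Qb y) ≤ 0.06 := by
    intro σ y hy hM
    have := Mt_sum hF hx hy hM
    rw [Mt_vol hM]
    obtain ⟨⟨a, a'⟩, ⟨b, b'⟩, c, c'⟩ := hM
    apply prod_le <;> linarith
  rcases lo_cases hF hx true s t with h1 | ⟨y, hy, hMy, h1⟩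
  · rcases lo_cases hF hx false s t with h2 | ⟨z, hz, hMz, h2⟩
    · rw [h1, h2]; linarith
    · rw [h1, h2]; linarith [one _ z hz hMz]
  · rcases lo_cases hF hx false s t with h2 | ⟨z, hz, hMz, h2⟩
    · rw [h1, h2]; linarith [one _ y hy hMy]
    · rw [h1, h2, Mt_vol hMy, Mt_vol hMz]
      have sy := Mt_sum hF hx hy hMy
      have sz := Mt_sum hF hx hz hMz
      have hMy0 := hMy
      have hMz0 := hMz
      have k := hF z hz y hy
      obtain ⟨⟨a, a'⟩, ⟨b, b'⟩, c, c'⟩ := hMy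
      obtain ⟨⟨d, d'⟩, ⟨e, e'⟩, f, f'⟩ := hMz
      have g1 : sg true = 1 := by simp [sg]
      have g2 : sg false = -1 := by simp [sg]
      have q1 : |y 1 - z 1| = |(2 - sg s * (y 1 - x 1)) - (2 - sg s * (z 1 - x 1))| := by
        rw [← sg_sub_abs s, ← abs_neg]; congr 1; ring
      have q2 : |y 2 - z 2| = |(2 - sg t * (y 2 - x 2)) - (2 - sg t * (z 2 - x 2))| := by
        rw [← sg_sub_abs t, ← abs_neg]; congr 1; ring
      have key := key_ineq (a := 2 - sg true * (y 0 - x 0)) (b := 2 - sg s * (y 1 - x 1))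
        (c := 2 - sg t * (y 2 - x 2)) (a' := 2 - sg false * (z 0 - x 0)) (b' := 2 - sg s * (z 1 - x 1))
        (c' := 2 - sg t * (z 2 - x 2)) (V := volume.real (Ho F x s t)) (by linarith) (by linarith)
        (by linarith) (by linarith) (by linarith) (by linarith) (by linarith) (by linarith) hV0 ?_
      · linarith
      rw [← q1, ← q2]
      intro hA hD
      have hne : z ≠ y := by
        rintro rfl
        rw [g1] at a; rw [g2] at d; linarith
      rw [g1] at a a' sy hA ⊢
      rw [g2] at d d' sz hA ⊢
      have hgap : 2 ≤ y 0 - z 0 := by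
        by_contra hlt
        push Not at hlt
        have l1 : |y 0 - z 0| < 2 := by rw [abs_lt]; constructor <;> linarith
        have n1 := abs_nonneg (y 1 - z 1)
        have n2 := abs_nonneg (y 2 - z 2)
        have := k hne l1 (by linarith) (by linarith)
        linarith
      have hg : good x y z s t := ⟨hMy0, hMz0, by linarith, hD⟩
      have hsub : hole y z ⊆ Ho F x s t := by
        intro p hp
        simp only [Ho, Set.mem_iUnion]
        exact ⟨y, hy, z, hz, hg, hp⟩
      have hm := measureReal_mono (μ := volume) hsub (Ho_finite F x s t)
      rw [hole, bx_real] at hm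
      · simp only [Matrix.cons_val] at hm
        have e3 : (y 0 - 1 - (z 0 + 1)) * ((y 1 + z 1) / 2 + 0.16 - ((y 1 + z 1) / 2 - 0.16)) *
          ((y 2 + z 2) / 2 + 0.16 - ((y 2 + z 2) / 2 - 0.16)) = 0.1024 * (y 0 - z 0 - 2) := by ring
        linarith
      · intro i
        fin_cases i <;> simp <;> linarith

lemma overlap_sum {F : Finset E3} (hF : Sepd F) {x : E3} (hx : x ∈ F) :
    ∑ y ∈ F with y ≠ x, volume.real (Qb x ∩ Qb y) ≤ ∑ s, ∑ t, ∑ σ, lo F x σ s t := by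
  classical
  have : ∑ s, ∑ t, ∑ σ, lo F x σ s t = ∑ y ∈ F, ∑ s, ∑ t, ∑ σ,
      if Mt x y σ s t then volume.real (Qb x ∩ Qb y) else 0 := by
    simp only [Fintype.sum_bool, lo, Finset.sum_filter, Finset.sum_add_distrib]
  rw [this, Finset.sum_filter]
  refine Finset.sum_le_sum fun y hy => ?_
  have nn : ∀ s t σ, 0 ≤ (if Mt x y σ s t then volume.real (Qb x ∩ Qb y) else 0) := by
    intro s t σ; split_ifs
    · exact measureReal_nonneg
    · exact le_rfl
  have nn1 : ∀ s t, 0 ≤ ∑ σ, (if Mt x y σ s t then volume.real (Qb x ∩ Qb y) else 0) :=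
    fun s t => Finset.sum_nonneg fun σ _ => nn s t σ
  have nn2 : ∀ s, 0 ≤ ∑ t, ∑ σ, (if Mt x y σ s t then volume.real (Qb x ∩ Qb y) else 0) :=
    fun s => Finset.sum_nonneg fun t _ => nn1 s t
  have nn3 : 0 ≤ ∑ s, ∑ t, ∑ σ, (if Mt x y σ s t then volume.real (Qb x ∩ Qb y) else 0) :=
    Finset.sum_nonneg fun s _ => nn2 s
  split_ifs with hne
  · by_cases hE : (Qb x ∩ Qb y).Nonempty
    · obtain ⟨σ, s, t, hM⟩ := exists_Mt hF hx hy (Ne.symm hne) hE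
      calc volume.real (Qb x ∩ Qb y) = (if Mt x y σ s t then volume.real (Qb x ∩ Qb y) else 0) := by
            rw [if_pos hM]
        _ ≤ ∑ σ, (if Mt x y σ s t then volume.real (Qb x ∩ Qb y) else 0) :=
            Finset.single_le_sum (f := fun σ => (if Mt x y σ s t then volume.real (Qb x ∩ Qb y) else 0))
              (fun σ _ => nn s t σ) (Finset.mem_univ σ)
        _ ≤ ∑ t, ∑ σ, (if Mt x y σ s t then volume.real (Qb x ∩ Qb y) else 0) :=
            Finset.single_le_sum
              (f := fun t => ∑ σ, (if Mt x y σ s t then volume.real (Qb x ∩ Qb y) else 0))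
              (fun t _ => nn1 s t) (Finset.mem_univ t)
        _ ≤ _ := Finset.single_le_sum
              (f := fun s => ∑ t, ∑ σ, (if Mt x y σ s t then volume.real (Qb x ∩ Qb y) else 0))
              (fun s _ => nn2 s) (Finset.mem_univ s)
    · rw [Set.not_nonempty_iff_eq_empty] at hE
      rw [hE, measureReal_empty]
      simp
  · exact nn3

lemma per_x {F : Finset E3} (hF : Sepd F) {x : E3} (hx : x ∈ F) :
    7.853 ≤ volume.real (Qb x) - (∑ y ∈ F with y ≠ x, volume.real (Qb x ∩ Qb y)) / 2
      + (∑ s, ∑ t, volume.real (Ho F x s t)) / 4 := by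
  have h1 := overlap_sum hF hx
  have h2 : volume.real (Qb x) = 8 := by
    rw [Qb, bx_real]
    · ring
    · intro i; linarith
  simp only [Fintype.sum_bool] at h1 ⊢
  have e1 := edge hF hx true true
  have e2 := edge hF hx true false
  have e3 := edge hF hx false true
  have e4 := edge hF hx false false
  rw [h2]
  linarith

/-- indicator function -/
noncomputable def ic (S : Set E3) : E3 → ℝ := S.indicator (fun _ => (1 : ℝ))

lemma ic_one {S : Set E3} {p : E3} (h : p ∈ S) : ic S p = 1 := Set.indicator_of_mem h _
lemma ic_zero {S : Set E3} {p : E3} (h : p ∉ S) : ic S p = 0 := Set.indicator_of_notMem h _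
lemma ic_nonneg (S : Set E3) (p : E3) : 0 ≤ ic S p := by
  by_cases h : p ∈ S
  · rw [ic_one h]; norm_num
  · rw [ic_zero h]
lemma ic_inter (S T : Set E3) (p : E3) : ic (S ∩ T) p = ic S p * ic T p := by
  by_cases h : p ∈ S
  · by_cases h' : p ∈ T
    · rw [ic_one h, ic_one h', ic_one (Set.mem_inter h h')]; norm_num
    · rw [ic_zero h', ic_zero fun k => h' k.2]; norm_num
  · rw [ic_zero h, ic_zero fun k => h k.1]; norm_num

lemma ic_int {S : Set E3} (hS : MeasurableSet S) (hf : volume S ≠ ⊤) : Integrable (ic S) volume :=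
  (integrable_indicator_iff hS).2 (integrableOn_const hf)

lemma ic_integral {S : Set E3} (hS : MeasurableSet S) : ∫ p, ic S p = volume.real S := by
  have := integral_indicator_one (μ := (volume : Measure E3)) hS
  rw [← this]; rfl

lemma pointwise {F : Finset E3} (hF : Sepd F) {B : Set E3} (hQ : ∀ x ∈ F, Qb x ⊆ B)
    (hH : ∀ x ∈ F, ∀ s t, Ho F x s t ⊆ B) (p : E3) :
    ∑ x ∈ F, (ic (Qb x) p - (∑ y ∈ F with y ≠ x, ic (Qb x ∩ Qb y) p) / 2 +
      (∑ s, ∑ t, ic (Ho F x s t) p) / 4) ≤ ic B p := by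
  classical
  by_cases hh : ∃ x ∈ F, ∃ s t, p ∈ Ho F x s t
  · have hB : ic B p = 1 := by
      obtain ⟨x, hx, s, t, h⟩ := hh
      exact ic_one (hH x hx s t h)
    have hz : ∀ w ∈ F, ic (Qb w) p = 0 := by
      intro w hw
      obtain ⟨x, hx, s, t, h⟩ := hh
      simp only [Ho, Set.mem_iUnion] at h
      obtain ⟨y, hy, z, hz, hg, hp⟩ := h
      exact ic_zero (hole_empty hF hx hy hz hw hg hp)
    have hone : ∀ s t, ∑ x ∈ F, ic (Ho F x s t) p ≤ 1 := by
      intro s t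
      by_cases h : ∃ x ∈ F, p ∈ Ho F x s t
      · obtain ⟨x, hx, h⟩ := h
        rw [Finset.sum_eq_single x, ic_one h]
        · intro x' hx' hne
          refine ic_zero fun h' => hne ?_
          simp only [Ho, Set.mem_iUnion] at h h'
          obtain ⟨y, hy, z, hz, hg, hp⟩ := h
          obtain ⟨y', hy', z', hz', hg', hp'⟩ := h'
          exact hole_unique hF hx' hy' hx hy hg' hp' hg hp
        · intro h; exact absurd hx h
      · rw [Finset.sum_eq_zero]
        · norm_num
        · intro x hx
          exact ic_zero fun h' => h ⟨x, hx, h'⟩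
    have e : ∀ x ∈ F, (ic (Qb x) p - (∑ y ∈ F with y ≠ x, ic (Qb x ∩ Qb y) p) / 2 +
      (∑ s, ∑ t, ic (Ho F x s t) p) / 4) ≤ (∑ s, ∑ t, ic (Ho F x s t) p) / 4 := by
      intro x hx
      have : 0 ≤ ∑ y ∈ F with y ≠ x, ic (Qb x ∩ Qb y) p := Finset.sum_nonneg fun y _ => ic_nonneg _ _
      rw [hz x hx]; linarith
    refine (Finset.sum_le_sum e).trans ?_
    rw [hB]
    simp only [Fintype.sum_bool]
    rw [← Finset.sum_div]
    simp only [Finset.sum_add_distrib]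
    have e1 := hone true true
    have e2 := hone true false
    have e3 := hone false true
    have e4 := hone false false
    linarith
  · push Not at hh
    have hz : ∀ x ∈ F, (∑ s, ∑ t, ic (Ho F x s t) p) = 0 := fun x hx =>
      Finset.sum_eq_zero fun s _ => Finset.sum_eq_zero fun t _ => ic_zero (hh x hx s t)
    have e : ∀ x ∈ F, (ic (Qb x) p - (∑ y ∈ F with y ≠ x, ic (Qb x ∩ Qb y) p) / 2 +
      (∑ s, ∑ t, ic (Ho F x s t) p) / 4) =
        ic (Qb x) p * (3 / 2) - ic (Qb x) p * (∑ y ∈ F, ic (Qb y) p) / 2 := by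
      intro x hx
      rw [hz x hx]
      have h2 : ∑ y ∈ F with y ≠ x, ic (Qb x ∩ Qb y) p =
          ∑ y ∈ F, ic (Qb x ∩ Qb y) p - ic (Qb x) p := by
        rw [Finset.filter_ne' , ← Finset.sum_erase_add F _ hx, Set.inter_self]; ring
      rw [h2]
      simp only [ic_inter]
      rw [← Finset.mul_sum]
      ring
    rw [Finset.sum_congr rfl e, Finset.sum_sub_distrib, ← Finset.sum_div, ← Finset.sum_mul,
      ← Finset.sum_mul]
    have hN : ∑ y ∈ F, ic (Qb y) p = ((F.filter fun y => p ∈ Qb y).card : ℝ) := by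
      rw [Finset.card_eq_sum_ones, Finset.sum_filter]
      push_cast
      refine Finset.sum_congr rfl fun y _ => ?_
      split_ifs with h
      · exact ic_one h
      · exact ic_zero h
    rw [hN]
    by_cases hB : p ∈ B
    · rw [ic_one hB]
      generalize (F.filter fun y => p ∈ Qb y).card = N
      rcases N with _ | _ | N
      · norm_num
      · norm_num
      · push_cast
        nlinarith [(Nat.cast_nonneg N : (0 : ℝ) ≤ N)]
    · have : (F.filter fun y => p ∈ Qb y).card = 0 := by
        rw [Finset.card_eq_zero, Finset.filter_eq_empty_iff]
        intro x hx h
        exact hB (hQ x hx h)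
      rw [this, ic_zero hB]
      norm_num

lemma Qb_finite (x : E3) : volume (Qb x) ≠ ⊤ := by
  rw [Qb, bx_vol]
  exact (ENNReal.prod_lt_top fun i _ => ENNReal.ofReal_lt_top).ne

lemma bound_B {F : Finset E3} (hF : Sepd F) {B : Set E3} (hB : MeasurableSet B)
    (hBf : volume B ≠ ⊤) (hQ : ∀ x ∈ F, Qb x ⊆ B)
    (hH : ∀ x ∈ F, ∀ s t, Ho F x s t ⊆ B) : 7.853 * (F.card : ℝ) ≤ volume.real B := by
  have iQ : ∀ x, Integrable (fun p => ic (Qb x) p) volume := fun x => ic_int (bx_meas _ _) (Qb_finite x)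
  have iI : ∀ x y, Integrable (fun p => ic (Qb x ∩ Qb y) p) volume := fun x y =>
    ic_int ((bx_meas _ _).inter (bx_meas _ _))
      (measure_ne_top_of_subset Set.inter_subset_left (Qb_finite x))
  have iH : ∀ x s t, Integrable (fun p => ic (Ho F x s t) p) volume := fun x s t =>
    ic_int (Ho_meas _ _ _ _) (Ho_finite _ _ _ _)
  have iS : ∀ x, Integrable (fun p => ∑ y ∈ F with y ≠ x, ic (Qb x ∩ Qb y) p) volume := fun x =>
    integrable_finsetSum _ fun y _ => iI x y
  have iT : ∀ x, Integrable (fun p => ∑ s, ∑ t, ic (Ho F x s t) p) volume := fun x =>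
    integrable_finsetSum _ fun s _ => integrable_finsetSum _ fun t _ => iH x s t
  have iA : ∀ x, Integrable (fun p => ic (Qb x) p - (∑ y ∈ F with y ≠ x, ic (Qb x ∩ Qb y) p) / 2)
    volume := fun x => (iQ x).sub ((iS x).div_const 2)
  have iX : ∀ x, Integrable (fun p => ic (Qb x) p - (∑ y ∈ F with y ≠ x, ic (Qb x ∩ Qb y) p) / 2 +
      (∑ s, ∑ t, ic (Ho F x s t) p) / 4) volume := fun x => (iA x).add ((iT x).div_const 4)
  have key := integral_mono (μ := (volume : Measure E3)) (integrable_finsetSum F fun x _ => iX x)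
    (ic_int hB hBf) (pointwise hF hQ hH)
  rw [ic_integral hB, integral_finsetSum F fun x _ => iX x] at key
  refine le_trans ?_ key
  rw [mul_comm, ← nsmul_eq_mul]
  refine Finset.card_nsmul_le_sum F _ _ fun x hx => ?_
  refine (per_x hF hx).trans (le_of_eq ?_)
  rw [integral_add (iA x) ((iT x).div_const 4), integral_sub (iQ x) ((iS x).div_const 2),
    integral_div, integral_div, integral_finsetSum _ fun y _ => iI x y,
    integral_finsetSum _ fun s _ => integrable_finsetSum _ fun t _ => iH x s t,
    ic_integral (S := Qb x) (bx_meas _ _)]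
  congr 2
  · congr 1
    congr 1
    funext y
    exact (ic_integral (S := Qb x ∩ Qb y) ((bx_meas _ _).inter (bx_meas _ _))).symm
  · refine Finset.sum_congr rfl fun s _ => ?_
    rw [integral_finsetSum _ fun t _ => iH x s t]
    exact Finset.sum_congr rfl fun t _ => (ic_integral (Ho_meas _ _ _ _)).symm

lemma dist_coord (x y : E3) {M : ℝ} (h : ∀ i, |x i - y i| ≤ M) : dist x y ≤ 2 * M := by
  have h0 : 0 ≤ M := (abs_nonneg _).trans (h 0)
  rw [EuclideanSpace.dist_eq, Fin.sum_univ_three]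
  apply Real.sqrt_le_iff.2
  refine ⟨by linarith, ?_⟩
  simp only [Real.dist_eq, sq_abs]
  have h1 := abs_le.1 (h 0)
  have h2 := abs_le.1 (h 1)
  have h3 := abs_le.1 (h 2)
  nlinarith [sq_nonneg M]

lemma finite_bound {F : Finset E3} (hF : Sepd F) {c : E3} {R : ℝ} (hc : ∀ x ∈ F, x ∈ closedBall c R) :
    7.853 * (F.card : ℝ) ≤ volume.real (closedBall c (R + 10)) := by
  have main : ∀ x ∈ F, ∀ p : E3, (∀ i, |p i - x i| ≤ 5) → p ∈ closedBall c (R + 10) := by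
    intro x hx p hp
    have h1 := dist_coord p x hp
    have h2 := hc x hx
    rw [mem_closedBall] at h2 ⊢
    linarith [dist_triangle p x c]
  refine bound_B hF measurableSet_closedBall measure_closedBall_lt_top.ne ?_ ?_
  · intro x hx p hp
    rw [mem_Qb] at hp
    refine main x hx p fun i => ?_
    fin_cases i
    · exact hp.1.le.trans (by norm_num)
    · exact hp.2.1.le.trans (by norm_num)
    · exact hp.2.2.le.trans (by norm_num)
  · intro x hx s t p hp
    simp only [Ho, Set.mem_iUnion] at hp
    obtain ⟨y, hy, z, hz, ⟨hMy, hMz, -, -⟩, hp⟩ := hp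
    rw [mem_hole] at hp
    obtain ⟨⟨a, a'⟩, ⟨b, b'⟩, c, c'⟩ := hMy
    obtain ⟨⟨d, d'⟩, ⟨e, e'⟩, f, f'⟩ := hMz
    rw [← sg_abs a, abs_lt] at a'
    rw [← sg_abs b, abs_lt] at b'
    rw [← sg_abs c, abs_lt] at c'
    rw [← sg_abs d, abs_lt] at d'
    rw [← sg_abs e, abs_lt] at e'
    rw [← sg_abs f, abs_lt] at f'
    obtain ⟨p0, p1, p2⟩ := hp
    rw [abs_lt] at p1 p2
    refine main x hx p fun i => ?_
    fin_cases i
    · simp only [Fin.zero_eta]; rw [abs_le]; constructor <;> linarith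
    · simp only [Fin.mk_one]; rw [abs_le]; constructor <;> linarith
    · simp only [Fin.reduceFinMk]; rw [abs_le]; constructor <;> linarith

/-- the vertices of the truncated cube -/
def VS : Set E3 := {v : EuclideanSpace ℝ (Fin 3) | ∃ (σ : Equiv.Perm (Fin 3)) (s₁ s₂ s₃ : ℝ),
        (s₁ = 1 ∨ s₁ = -1) ∧ (s₂ = 1 ∨ s₂ = -1) ∧ (s₃ = 1 ∨ s₃ = -1) ∧
        v = fun i => ![s₁ * (Real.sqrt 2 - 1), s₂, s₃] (σ i)}

/-- the truncated cube by inequalities -/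
def PT : Set E3 := {d | (|d 0| ≤ 1 ∧ |d 1| ≤ 1 ∧ |d 2| ≤ 1) ∧
  |d 0| + |d 1| + |d 2| ≤ 1 + Real.sqrt 2}

lemma sqrt2_bd : 1.41421 < Real.sqrt 2 ∧ Real.sqrt 2 < 1.414214 := by
  constructor
  · exact Real.lt_sqrt_of_sq_lt (by norm_num)
  · rw [Real.sqrt_lt' (by norm_num)]; norm_num

lemma PT_convex : Convex ℝ PT := by
  intro x hx y hy a b ha hb hab
  obtain ⟨⟨h0, h1, h2⟩, h3⟩ := hx
  obtain ⟨⟨k0, k1, k2⟩, k3⟩ := hy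
  have e : ∀ i, |(a • x + b • y) i| ≤ a * |x i| + b * |y i| := by
    intro i
    have := abs_add_le (a * x i) (b * y i)
    rw [abs_mul, abs_mul, abs_of_nonneg ha, abs_of_nonneg hb] at this
    simpa using this
  have e0 := e 0
  have e1 := e 1
  have e2 := e 2
  have m : ∀ u v w : ℝ, u ≤ w → v ≤ w → a * u + b * v ≤ w := by
    intro u v w hu hv
    have h1 := mul_le_mul_of_nonneg_left hu ha
    have h2 := mul_le_mul_of_nonneg_left hv hb
    have : w = a * w + b * w := by rw [← add_mul, hab, one_mul]
    linarith
  refine ⟨⟨e0.trans (m _ _ _ h0 k0), e1.trans (m _ _ _ h1 k1), e2.trans (m _ _ _ h2 k2)⟩, ?_⟩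
  have := m _ _ _ h3 k3
  linarith

lemma VS_coord {v : E3} (hv : v ∈ VS) :
    (∀ i, v i ∈ ({Real.sqrt 2 - 1, -(Real.sqrt 2 - 1), 1, -1} : Set ℝ)) ∧ v ∈ PT := by
  obtain ⟨σ, s₁, s₂, s₃, h1, h2, h3, hv⟩ := hv
  have hb := sqrt2_bd
  have hw : ∀ j, ![s₁ * (Real.sqrt 2 - 1), s₂, s₃] j ∈
      ({Real.sqrt 2 - 1, -(Real.sqrt 2 - 1), 1, -1} : Set ℝ) := by
    intro j
    fin_cases j
    · rcases h1 with rfl | rfl <;> simp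
    · rcases h2 with rfl | rfl <;> simp
    · rcases h3 with rfl | rfl <;> simp
  have hm : ∀ i, v i ∈ ({Real.sqrt 2 - 1, -(Real.sqrt 2 - 1), 1, -1} : Set ℝ) := by
    intro i; rw [hv]; exact hw _
  have ha : ∀ i, |v i| ≤ 1 := by
    intro i
    have := hm i
    simp only [Set.mem_insert_iff, Set.mem_singleton_iff] at this
    rcases this with h | h | h | h <;> rw [h, abs_le] <;> constructor <;> linarith
  refine ⟨hm, ⟨ha 0, ha 1, ha 2⟩, ?_⟩
  have e := Equiv.sum_comp σ (fun j => |![s₁ * (Real.sqrt 2 - 1), s₂, s₃] j|)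
  simp only [Fin.sum_univ_three] at e
  rw [hv]
  refine e.le.trans ?_
  simp only [Matrix.cons_val]
  have q1 : |s₁ * (Real.sqrt 2 - 1)| = Real.sqrt 2 - 1 := by
    rcases h1 with rfl | rfl
    · rw [one_mul, abs_of_pos (by linarith)]
    · rw [neg_one_mul, abs_neg, abs_of_pos (by linarith)]
  have q2 : |s₂| = 1 := by rcases h2 with rfl | rfl <;> simp
  have q3 : |s₃| = 1 := by rcases h3 with rfl | rfl <;> simp
  rw [q1, q2, q3]; linarith

lemma VS_finite : VS.Finite := by
  have hf : (Set.univ.pi fun _ : Fin 3 =>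
      ({Real.sqrt 2 - 1, -(Real.sqrt 2 - 1), 1, -1} : Set ℝ)).Finite :=
    Set.Finite.pi fun i => Set.toFinite _
  refine (hf.preimage (f := fun p : E3 => p.ofLp)
    ((WithLp.ofLp_injective 2).injOn)).subset ?_
  intro v hv i _
  exact (VS_coord hv).1 i

lemma hull_sub : convexHull ℝ VS ⊆ PT := convexHull_min (fun _ hv => (VS_coord hv).2) PT_convex

lemma exists_s (r : ℝ) : ∃ s : ℝ, (s = 1 ∨ s = -1) ∧ r * s = |r| := by
  rcases le_total 0 r with h | h
  · exact ⟨1, Or.inl rfl, by rw [abs_of_nonneg h, mul_one]⟩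
  · exact ⟨-1, Or.inr rfl, by rw [abs_of_nonpos h]; ring⟩

lemma vert_bd {a b c t0 t1 t2 L : ℝ} (ha : 0 ≤ a) (hb : a ≤ b) (hc : a ≤ c) (h0 : t0 ≤ 1)
    (h1 : t1 ≤ 1) (h2 : t2 ≤ 1) (hs : t0 + t1 + t2 ≤ 1 + L) :
    a * t0 + b * t1 + c * t2 ≤ a * (L - 1) + b + c := by
  nlinarith [mul_nonneg (sub_nonneg.2 hb) (sub_nonneg.2 h1),
    mul_nonneg (sub_nonneg.2 hc) (sub_nonneg.2 h2), mul_nonneg ha (sub_nonneg.2 hs)]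

lemma sub_hull : PT ⊆ convexHull ℝ VS := by
  intro d hd
  by_contra hn
  obtain ⟨f, u, hf, hu⟩ := geometric_hahn_banach_closed_point (convex_convexHull ℝ VS)
    (VS_finite.isClosed_convexHull ℝ) hn
  have hf' : ∀ v ∈ VS, f v < f d := fun v hv => (hf v (subset_convexHull ℝ _ hv)).trans hu
  obtain ⟨⟨h0, h1, h2⟩, h3⟩ := hd
  set g : Fin 3 → ℝ := fun i => f (EuclideanSpace.single i 1) with hg
  have hfe : ∀ v : E3, f v = g 0 * v 0 + g 1 * v 1 + g 2 * v 2 := by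
    intro v
    have : v = v 0 • EuclideanSpace.single (0 : Fin 3) (1 : ℝ) + v 1 • EuclideanSpace.single (1 : Fin 3) (1 : ℝ)
        + v 2 • EuclideanSpace.single (2 : Fin 3) (1 : ℝ) := by
      ext i
      fin_cases i <;> simp
    conv_lhs => rw [this]
    simp only [map_add, map_smul, smul_eq_mul, hg]
    ring
  have hup : f d ≤ |g 0| * |d 0| + |g 1| * |d 1| + |g 2| * |d 2| := by
    rw [hfe]
    have e0 := le_abs_self (g 0 * d 0)
    have e1 := le_abs_self (g 1 * d 1)
    have e2 := le_abs_self (g 2 * d 2)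
    rw [abs_mul] at e0 e1 e2
    linarith
  obtain ⟨s0, hs0, k0⟩ := exists_s (g 0)
  obtain ⟨s1, hs1, k1⟩ := exists_s (g 1)
  obtain ⟨s2, hs2, k2⟩ := exists_s (g 2)
  have n0 := abs_nonneg (g 0)
  have n1 := abs_nonneg (g 1)
  have n2 := abs_nonneg (g 2)
  have c0 : ¬ (|g 0| ≤ |g 1| ∧ |g 0| ≤ |g 2|) := by
    rintro ⟨l1, l2⟩
    have := hf' !₂[s0 * (Real.sqrt 2 - 1), s1, s2] ⟨1, s0, s1, s2, hs0, hs1, hs2, by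
      funext i; fin_cases i <;> rfl⟩
    rw [hfe] at this
    simp only [PiLp.toLp_apply, Matrix.cons_val] at this
    rw [← mul_assoc, k0, k1, k2] at this
    have := vert_bd n0 l1 l2 h0 h1 h2 h3
    linarith
  have c1 : ¬ (|g 1| ≤ |g 0| ∧ |g 1| ≤ |g 2|) := by
    rintro ⟨l1, l2⟩
    have := hf' !₂[s0, s1 * (Real.sqrt 2 - 1), s2] ⟨Equiv.swap 0 1, s1, s0, s2, hs1, hs0, hs2, by
      funext i; fin_cases i <;> rfl⟩
    rw [hfe] at this
    simp only [PiLp.toLp_apply, Matrix.cons_val] at this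
    rw [← mul_assoc, k0, k1, k2] at this
    have := vert_bd n1 l1 l2 h1 h0 h2 (L := Real.sqrt 2) (by linarith)
    linarith
  have c2 : ¬ (|g 2| ≤ |g 0| ∧ |g 2| ≤ |g 1|) := by
    rintro ⟨l1, l2⟩
    have := hf' !₂[s0, s1, s2 * (Real.sqrt 2 - 1)] ⟨Equiv.swap 0 2, s2, s1, s0, hs2, hs1, hs0, by
      funext i; fin_cases i <;> rfl⟩
    rw [hfe] at this
    simp only [PiLp.toLp_apply, Matrix.cons_val] at this
    rw [← mul_assoc, k0, k1, k2] at this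
    have := vert_bd n2 l1 l2 h2 h0 h1 (L := Real.sqrt 2) (by linarith)
    linarith
  rcases le_total |g 0| |g 1| with l | l <;> rcases le_total |g 1| |g 2| with l' | l' <;>
    rcases le_total |g 0| |g 2| with l'' | l''
  · exact c0 ⟨l, l''⟩
  · exact c0 ⟨l, l.trans l'⟩
  · exact c0 ⟨l, l''⟩
  · exact c2 ⟨l'', l'⟩
  · exact c1 ⟨l, l'⟩
  · exact c1 ⟨l, l'⟩
  · exact c2 ⟨l'.trans l, l'⟩
  · exact c2 ⟨l'', l'⟩

lemma hull_eq : convexHull ℝ VS = PT := hull_sub.antisymm sub_hull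

lemma mem_int {d : E3} (h0 : |d 0| < 1) (h1 : |d 1| < 1) (h2 : |d 2| < 1)
    (h3 : |d 0| + |d 1| + |d 2| < 1 + Real.sqrt 2) : d ∈ interior PT := by
  rw [mem_interior]
  refine ⟨{d | |d 0| < 1} ∩ {d | |d 1| < 1} ∩ {d | |d 2| < 1} ∩
    {d | |d 0| + |d 1| + |d 2| < 1 + Real.sqrt 2}, ?_, ?_, ⟨⟨⟨h0, h1⟩, h2⟩, h3⟩⟩
  · rintro d ⟨⟨⟨h0, h1⟩, h2⟩, h3⟩
    exact ⟨⟨le_of_lt h0, le_of_lt h1, le_of_lt h2⟩, le_of_lt h3⟩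
  · refine ((IsOpen.inter ?_ ?_).inter ?_).inter ?_ <;>
    exact isOpen_lt (by fun_prop) continuous_const

lemma sepd_of_packing {X : Set E3} (hX : IsTranslativePacking PT X) {F : Finset E3}
    (hF : ↑F ⊆ X) : Sepd F := by
  intro x hx y hy hne a0 a1 a2
  by_contra hlt
  push Not at hlt
  have hb := sqrt2_bd
  have key := hX x (hF hx) y (hF hy) hne
  have half : ∀ r : ℝ, |r / 2| = |r| / 2 := fun r => by rw [abs_div]; norm_num
  have hd : ∀ ε : ℝ, |ε| = 1 → (ε / 2) • (y - x) ∈ interior PT := by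
    intro ε hε
    have e : ∀ i, |((ε / 2) • (y - x)) i| = |y i - x i| / 2 := by
      intro i
      simp only [PiLp.smul_apply, PiLp.sub_apply, smul_eq_mul]
      rw [abs_mul, half, hε]; ring
    apply mem_int <;> simp only [e] <;> linarith
  have m1 : x + (1 / 2 : ℝ) • (y - x) ∈ (fun z => x + z) '' interior PT :=
    ⟨(1 / 2 : ℝ) • (y - x), hd 1 (by simp), rfl⟩
  have m2 : x + (1 / 2 : ℝ) • (y - x) ∈ (fun z => y + z) '' interior PT := by
    refine ⟨(-1 / 2 : ℝ) • (y - x), hd (-1) (by simp), ?_⟩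
    ext i
    simp
    ring
  exact Set.disjoint_left.1 key m1 m2

/-- the open `L1` ball -/
def DD (L : ℝ) : Set E3 := {v | |v 0| + |v 1| + |v 2| < L}

lemma DD_meas (L : ℝ) : MeasurableSet (DD L) :=
  (isOpen_lt (by fun_prop) continuous_const).measurableSet

lemma DD_vol {L : ℝ} (hL : 0 ≤ L) : volume (DD L) = ENNReal.ofReal (4 / 3 * L ^ 3) := by
  have e : DD L = (fun p : E3 => p.ofLp) ⁻¹' {x : Fin 3 → ℝ | (∑ i, |x i| ^ (1 : ℝ)) ^ (1 / (1 : ℝ)) < L} := by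
    ext v
    simp [DD, Fin.sum_univ_three]
  have hm : MeasurableSet {x : Fin 3 → ℝ | (∑ i, |x i| ^ (1 : ℝ)) ^ (1 / (1 : ℝ)) < L} := by
    simp only [Real.rpow_one, div_one]
    exact (isOpen_lt (by fun_prop) continuous_const).measurableSet
  rw [e, (PiLp.volume_preserving_ofLp (Fin 3)).measure_preimage hm.nullMeasurableSet,
    volume_sum_rpow_lt (Fin 3) le_rfl L, ← ENNReal.ofReal_pow hL, ← ENNReal.ofReal_mul (by positivity)]
  congr 1
  have g2 : Real.Gamma (1 / 1 + 1) = 1 := by norm_num [Real.Gamma_two]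
  have g4 : Real.Gamma ((Fintype.card (Fin 3) : ℝ) / 1 + 1) = 6 := by
    have := Real.Gamma_nat_eq_factorial 3
    rw [Fintype.card_fin, div_one, this]
    norm_num [Nat.factorial]
  rw [g2, g4, Fintype.card_fin]
  ring

/-- octant of the `L1` ball -/
def Oc (L : ℝ) (b : Fin 3 → Bool) : Set E3 := DD L ∩ {v | ∀ i, 0 ≤ sg (b i) * v i}

lemma Oc_meas (L : ℝ) (b : Fin 3 → Bool) : MeasurableSet (Oc L b) := by
  refine (DD_meas L).inter ?_
  have : {v : E3 | ∀ i, 0 ≤ sg (b i) * v i} = ⋂ i, {v : E3 | 0 ≤ sg (b i) * v i} := by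
    ext v; simp
  rw [this]
  exact MeasurableSet.iInter fun i => (isClosed_le continuous_const (by fun_prop)).measurableSet

lemma DD_sub (L : ℝ) : DD L ⊆ ⋃ b, Oc L b := by
  intro v hv
  rw [Set.mem_iUnion]
  refine ⟨fun i => decide (0 ≤ v i), hv, fun i => ?_⟩
  by_cases h : 0 ≤ v i
  · simp [sg, h]
  · simp only [sg, h, decide_false]
    push Not at h
    simp; exact h.le

/-- the corner cut off -/
def Tc (L : ℝ) (b : Fin 3 → Bool) : Set E3 :=
  (fun p : E3 => (WithLp.toLp 2 (fun i => sg (b i)) : E3) - p) ⁻¹' Oc L b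

lemma Tc_meas (L : ℝ) (b : Fin 3 → Bool) : MeasurableSet (Tc L b) :=
  (Measure.measurePreserving_sub_left volume _).measurable (Oc_meas L b)

lemma Tc_vol (L : ℝ) (b : Fin 3 → Bool) : volume (Tc L b) = volume (Oc L b) :=
  (Measure.measurePreserving_sub_left volume _).measure_preimage (Oc_meas L b).nullMeasurableSet

lemma Tc_mem {L : ℝ} {b : Fin 3 → Bool} {p : E3} (h : p ∈ Tc L b) :
    (∀ i, sg (b i) * p i ≤ 1) ∧ 3 - L < sg (b 0) * p 0 + sg (b 1) * p 1 + sg (b 2) * p 2 := by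
  obtain ⟨h1, h2⟩ := h
  have sq : ∀ c : Bool, sg c * sg c = 1 := by intro c; cases c <;> simp [sg]
  have e : ∀ i, sg (b i) * (sg (b i) - p i) = 1 - sg (b i) * p i := by
    intro i; rw [mul_sub, sq]
  have h2' : ∀ i, 0 ≤ sg (b i) * (sg (b i) - p i) := h2
  have ab : ∀ i, |sg (b i) - p i| = 1 - sg (b i) * p i := by
    intro i
    rw [← sg_sub_abs (b i), abs_of_nonneg (h2' i), e]
  have h1' : |sg (b 0) - p 0| + |sg (b 1) - p 1| + |sg (b 2) - p 2| < L := h1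
  rw [ab, ab, ab] at h1'
  refine ⟨fun i => ?_, by linarith⟩
  have := h2' i
  rw [e] at this
  linarith

/-- closed cube -/
def CC : Set E3 := (fun p : E3 => p.ofLp) ⁻¹' (Set.univ.pi fun _ => Set.Icc (-1) 1)

lemma CC_vol : volume CC = 8 := by
  rw [CC, (PiLp.volume_preserving_ofLp (Fin 3)).measure_preimage
    (MeasurableSet.univ_pi fun i => measurableSet_Icc).nullMeasurableSet, volume_pi_pi]
  simp only [Real.volume_Icc, Finset.prod_const, Finset.card_univ, Fintype.card_fin]
  rw [← ENNReal.ofReal_pow (by norm_num)]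
  norm_num

lemma Tc_pos {L : ℝ} (hL : L < 1) {b : Fin 3 → Bool} {p : E3} (h : p ∈ Tc L b) (i : Fin 3) :
    0 < sg (b i) * p i := by
  obtain ⟨h1, h2⟩ := Tc_mem h
  have a0 := h1 0
  have a1 := h1 1
  have a2 := h1 2
  fin_cases i
  · simp only [Fin.zero_eta]; linarith
  · simp only [Fin.mk_one]; linarith
  · simp only [Fin.reduceFinMk]; linarith

lemma PT_vol : volume PT + ENNReal.ofReal (4 / 3 * (2 - Real.sqrt 2) ^ 3) ≤ 8 := by
  have hb := sqrt2_bd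
  have hL : 2 - Real.sqrt 2 < 1 := by linarith
  rw [← DD_vol (by linarith), ← CC_vol]
  have hd : Pairwise (Function.onFun Disjoint (Tc (2 - Real.sqrt 2))) := by
    intro b b' hne
    refine Set.disjoint_left.2 fun p hp hp' => hne ?_
    funext i
    have h1 := Tc_pos hL hp i
    have h2 := Tc_pos hL hp' i
    cases h : b i <;> cases h' : b' i <;> rw [h] at h1 <;> rw [h'] at h2 <;>
      simp [sg] at h1 h2 ⊢ <;> linarith
  have h1 : volume (DD (2 - Real.sqrt 2)) ≤ volume (⋃ b, Tc (2 - Real.sqrt 2) b) := by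
    rw [measure_iUnion hd fun b => Tc_meas _ b]
    simp only [Tc_vol]
    exact (measure_mono (DD_sub _)).trans (measure_iUnion_le _)
  refine (add_le_add_right h1 _).trans ?_
  rw [← measure_union _ (MeasurableSet.iUnion fun b => Tc_meas _ b)]
  · refine measure_mono (Set.union_subset ?_ (Set.iUnion_subset fun b => ?_))
    · rintro p ⟨⟨h0, h1, h2⟩, -⟩ i -
      fin_cases i
      · exact abs_le.1 h0
      · exact abs_le.1 h1
      · exact abs_le.1 h2
    · intro p hp i _
      have a1 := Tc_pos hL hp i
      have a2 := (Tc_mem hp).1 i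
      rw [← sg_abs a1] at a2
      exact abs_le.1 a2
  · refine Set.disjoint_left.2 fun p hp hp' => ?_
    rw [Set.mem_iUnion] at hp'
    obtain ⟨b, hp'⟩ := hp'
    have h3 := (Tc_mem hp').2
    rw [← sg_abs (Tc_pos hL hp' 0), ← sg_abs (Tc_pos hL hp' 1), ← sg_abs (Tc_pos hL hp' 2)] at h3
    linarith [hp.2]

lemma PT_real : volume PT ≤ ENNReal.ofReal 7.732 := by
  have hb := sqrt2_bd
  have h := PT_vol
  have h1 : (0.585786 : ℝ) ^ 3 ≤ (2 - Real.sqrt 2) ^ 3 := pow_le_pow_left₀ (by norm_num) (by linarith) 3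
  have h2 : ENNReal.ofReal 0.268 ≤ ENNReal.ofReal (4 / 3 * (2 - Real.sqrt 2) ^ 3) := by
    apply ENNReal.ofReal_le_ofReal
    refine le_trans ?_ (mul_le_mul_of_nonneg_left h1 (by norm_num))
    norm_num
  have h3 : volume PT + ENNReal.ofReal 0.268 ≤ ENNReal.ofReal 7.732 + ENNReal.ofReal 0.268 := by
    rw [← ENNReal.ofReal_add (by norm_num) (by norm_num)]
    refine ((add_le_add_right h2 _).trans h).trans ?_
    norm_num
  exact (ENNReal.add_le_add_iff_right ENNReal.ofReal_ne_top).1 h3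

lemma ball_real (c : E3) {r : ℝ} (hr : 0 ≤ r) :
    volume.real (closedBall c r) = r ^ 3 * volume.real (ball (0 : E3) 1) := by
  rw [Measure.real, Measure.addHaar_closedBall _ _ hr, ENNReal.toReal_mul,
    ENNReal.toReal_ofReal (by positivity), finrank_euclideanSpace_fin]
  rfl

lemma fin_S {X : Set E3} (hX : IsTranslativePacking PT X) (c : E3) (R : ℝ) :
    (X ∩ closedBall c R).Finite := by
  by_contra hinf
  obtain ⟨n, hn⟩ := exists_nat_gt (volume.real (closedBall c (R + 10)))
  obtain ⟨F, hF, hc⟩ := Set.Infinite.exists_subset_card_eq (s := X ∩ closedBall c R) hinf n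
  have := finite_bound (sepd_of_packing hX (hF.trans Set.inter_subset_left))
    (fun x hx => (hF hx).2)
  rw [hc] at this
  have h0 : (0 : ℝ) ≤ n := Nat.cast_nonneg n
  linarith

lemma vol_bound {X : Set E3} (hX : IsTranslativePacking PT X) (c : E3) (r : ℝ) :
    volume.real (closedBall c r ∩ ⋃ x ∈ X, (fun z => x + z) '' PT) ≤
      7.732 / 7.853 * volume.real (closedBall c (r + 12)) := by
  set F := (fin_S hX c (r + 2)).toFinset with hFd
  have hFm : ∀ x, x ∈ F ↔ x ∈ X ∧ x ∈ closedBall c (r + 2) := by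
    intro x; rw [hFd, Set.Finite.mem_toFinset]; rfl
  have hb := finite_bound (c := c) (R := r + 2)
    (sepd_of_packing hX (F := F) fun x hx => ((hFm x).1 hx).1) fun x hx => ((hFm x).1 hx).2
  rw [show r + 2 + 10 = r + 12 by ring] at hb
  have hsub : closedBall c r ∩ ⋃ x ∈ X, (fun z => x + z) '' PT ⊆ ⋃ x ∈ F, (fun z => x + z) '' PT := by
    rintro p ⟨hp, hp'⟩
    simp only [Set.mem_iUnion] at hp' ⊢
    obtain ⟨x, hx, z, hz, rfl⟩ := hp'
    refine ⟨x, (hFm x).2 ⟨hx, ?_⟩, z, hz, rfl⟩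
    have : dist x (x + z) ≤ 2 * 1 := by
      refine dist_coord _ _ fun i => ?_
      have e : x i - (x + z) i = - z i := by simp
      rw [e, abs_neg]
      obtain ⟨⟨h0, h1, h2⟩, -⟩ := hz
      fin_cases i
      · exact h0
      · exact h1
      · exact h2
    rw [mem_closedBall] at hp ⊢
    have hp2 : dist (x + z) c ≤ r := hp
    linarith [dist_triangle x (x + z) c]
  have hv : ∀ x : E3, volume ((fun z => x + z) '' PT) ≤ ENNReal.ofReal 7.732 := by
    intro x
    rw [Set.image_add_left, measure_preimage_add]
    exact PT_real
  have hm : volume (closedBall c r ∩ ⋃ x ∈ X, (fun z => x + z) '' PT) ≤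
      ENNReal.ofReal (F.card * 7.732) := by
    refine (measure_mono hsub).trans ((measure_biUnion_finset_le _ _).trans ?_)
    refine (Finset.sum_le_card_nsmul _ _ _ fun x _ => hv x).trans ?_
    rw [nsmul_eq_mul, ENNReal.ofReal_mul (Nat.cast_nonneg _), ENNReal.ofReal_natCast]
  have hm2 := ENNReal.toReal_mono ENNReal.ofReal_ne_top hm
  rw [ENNReal.toReal_ofReal (by positivity)] at hm2
  refine le_trans hm2 ?_
  rw [div_mul_eq_mul_div, le_div_iff₀ (by norm_num)]
  linarith

lemma ratio_bound {X : Set E3} (hX : IsTranslativePacking PT X) (c : E3) {r : ℝ}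
    (hr : 10 ^ 7 ≤ r) :
    (volume (closedBall c r ∩ ⋃ x ∈ X, (fun z => x + z) '' PT) /
      volume (closedBall c r)).toReal ≤ 0.9846 := by
  have hr0 : 0 < r := lt_of_lt_of_le (by norm_num) hr
  rw [ENNReal.toReal_div]
  have h := vol_bound hX c r
  have hκ : 0 < volume.real (ball (0 : E3) 1) :=
    ENNReal.toReal_pos (measure_ball_pos _ _ one_pos).ne' measure_ball_lt_top.ne
  rw [ball_real c (by linarith)] at h
  have e := ball_real c hr0.le
  change volume.real _ / volume.real _ ≤ _
  rw [e]
  rw [div_le_iff₀ (by positivity)]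
  refine h.trans ?_
  have h3 : (r + 12) ^ 3 ≤ (1.0000012 * r) ^ 3 := by
    refine pow_le_pow_left₀ (by linarith) ?_ 3
    linarith
  have h4 : 7.732 / 7.853 * (r + 12) ^ 3 ≤ 0.9846 * r ^ 3 := by
    have : 0 < r ^ 3 := by positivity
    rw [mul_pow] at h3
    norm_num at h3 ⊢
    linarith
  calc _ = (7.732 / 7.853 * (r + 12) ^ 3) * volume.real (ball (0 : E3) 1) := by ring
    _ ≤ (0.9846 * r ^ 3) * volume.real (ball (0 : E3) 1) :=
      mul_le_mul_of_nonneg_right h4 hκ.le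
    _ = _ := by ring

/-- Every translative packing of the truncated cube (the convex hull of all coordinate
permutations of `(±(√2 − 1), ±1, ±1)`) has upper density at most `0.9846`. -/
theorem truncated_cube_translative_packing_bound
    (TC : Set (EuclideanSpace ℝ (Fin 3)))
    (hTC : TC = convexHull ℝ
      {v : EuclideanSpace ℝ (Fin 3) | ∃ (σ : Equiv.Perm (Fin 3)) (s₁ s₂ s₃ : ℝ),
        (s₁ = 1 ∨ s₁ = -1) ∧ (s₂ = 1 ∨ s₂ = -1) ∧ (s₃ = 1 ∨ s₃ = -1) ∧
        v = fun i => ![s₁ * (Real.sqrt 2 - 1), s₂, s₃] (σ i)})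
    (X : Set (EuclideanSpace ℝ (Fin 3))) (hX : IsTranslativePacking TC X) :
    packingUpperDensity TC X ≤ 0.9846 := by
  have hT : TC = PT := hTC.trans hull_eq
  subst hT
  rw [packingUpperDensity]
  refine limsup_le_of_le (isCoboundedUnder_le_of_le (x := 0) _ fun r =>
    Real.iSup_nonneg fun c => ENNReal.toReal_nonneg) ?_
  filter_upwards [eventually_ge_atTop ((10 : ℝ) ^ 7)] with r hr
  exact Real.iSup_le (fun c => ratio_bound hX c hr) (by norm_num)
end
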